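/- Let G be a finite group which is neither cyclic nor isomorphic to a dihedral group of order 2n with n odd. Then D(G) ≤ (3/4)·|G|. -/

import Mathlib

/-- The set of all products of the terms of the multiset `S` taken in some order. -/
def prodSet {G : Type*} [Group G] (S : Multiset G) : Set G :=
  {g | ∃ l : List G, (l : Multiset G) = S ∧ l.prod = g}

/-- A sequence (multiset) over `G` is a product-one sequence if its terms can be
ordered so that their product is `1`. -/
def IsProductOne {G : Type*} [Group G] (S : Multiset G) : Prop :=
  (1 : G) ∈ prodSet S

/-- A minimal product-one sequence (atom): a nontrivial product-one sequence that cannot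
be partitioned into two nontrivial product-one subsequences. -/
def IsMinimalProductOne {G : Type*} [Group G] (S : Multiset G) : Prop :=
  S ≠ 0 ∧ IsProductOne S ∧
    ¬ ∃ T₁ T₂ : Multiset G, T₁ ≠ 0 ∧ T₂ ≠ 0 ∧ S = T₁ + T₂ ∧
      IsProductOne T₁ ∧ IsProductOne T₂

/-- The small Davenport constant: the maximal length of a sequence over `G` having
no nontrivial product-one subsequence. -/
noncomputable def smallDavenport (G : Type*) [Group G] : ℕ :=
  sSup {n | ∃ S : Multiset G, Multiset.card S = n ∧
    ∀ T : Multiset G, T ≤ S → T ≠ 0 → ¬ IsProductOne T}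

/-- The large Davenport constant: the maximal length of a minimal product-one sequence. -/
noncomputable def largeDavenport (G : Type*) [Group G] : ℕ :=
  sSup {n | ∃ S : Multiset G, Multiset.card S = n ∧ IsMinimalProductOne S}

section Basic

variable {G : Type*} [Group G]

theorem IsProductOne.of_list {l : List G} (h : l.prod = 1) : IsProductOne (l : Multiset G) :=
  ⟨l, rfl, h⟩

theorem List.prod_append_comm_eq_one {l₁ l₂ : List G} (h : (l₁ ++ l₂).prod = 1) :
    (l₂ ++ l₁).prod = 1 := by
  rw [List.prod_append] at h ⊢
  exact mul_eq_one_comm.mp h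

theorem Multiset.exists_map_eq_coe {α β : Type*} (f : α → β) (s : Multiset α) (l : List β)
    (h : s.map f = l) : ∃ L : List α, (L : Multiset α) = s ∧ L.map f = l := by
  classical
  induction l generalizing s with
  | nil =>
    refine ⟨[], ?_, rfl⟩
    have : s = 0 := by simpa using h
    simp [this]
  | cons b t ih =>
    have h' : s.map f = b ::ₘ (t : Multiset β) := by rw [h]; rfl
    obtain ⟨a, ha, hb, ht⟩ := (Multiset.map_eq_cons f s (t : Multiset β) b).mpr h'
    obtain ⟨L, hL, hm⟩ := ih (s.erase a) ht
    refine ⟨a :: L, ?_, by simp [hm, hb]⟩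
    rw [← Multiset.cons_coe, hL, Multiset.cons_erase ha]

theorem Multiset.exists_map_eq_add {α β : Type*} (f : α → β) (s : Multiset α)
    (t₁ t₂ : Multiset β) (h : s.map f = t₁ + t₂) :
    ∃ s₁ s₂, s = s₁ + s₂ ∧ s₁.map f = t₁ ∧ s₂.map f = t₂ := by
  induction t₁ using Quotient.inductionOn with | _ l₁
  induction t₂ using Quotient.inductionOn with | _ l₂
  obtain ⟨L, rfl, hL⟩ := Multiset.exists_map_eq_coe f s (l₁ ++ l₂) (by simpa using h)
  obtain ⟨L₁, L₂, rfl, rfl, rfl⟩ := List.map_eq_append_iff.mp hL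
  exact ⟨L₁, L₂, by simp, by simp, by simp⟩

theorem Multiset.coe_flatten {α : Type*} (L : List (List α)) :
    (L.flatten : Multiset α) = ((L : Multiset (List α)).map Multiset.ofList).sum := by
  induction L with
  | nil => simp
  | cons a L ih =>
    rw [List.flatten_cons, ← Multiset.coe_add, ih]
    simp

/-- Blocks of an atom cannot be split into two product-one collections. -/
theorem IsMinimalProductOne.blocks_false {S : Multiset G} (hS : IsMinimalProductOne S)
    (M : Multiset (List G)) (hne : ∀ b ∈ M, b ≠ [])
    (hM : S = (M.map Multiset.ofList).sum) {T₁ T₂ : Multiset G}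
    (h : M.map List.prod = T₁ + T₂) (h₁ : T₁ ≠ 0) (h₂ : T₂ ≠ 0) (hT₁ : IsProductOne T₁)
    (hT₂ : IsProductOne T₂) : False := by
  obtain ⟨M₁, M₂, rfl, hM₁, hM₂⟩ := Multiset.exists_map_eq_add _ _ _ _ h
  have key : ∀ (M' : Multiset (List G)) (T : Multiset G), (∀ b ∈ M', b ≠ []) →
      M'.map List.prod = T → T ≠ 0 → IsProductOne T →
      (M'.map Multiset.ofList).sum ≠ 0 ∧
      IsProductOne (M'.map Multiset.ofList).sum := by
    intro M' T hne' hMT hT hT1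
    obtain ⟨l, rfl, hl⟩ := hT1
    obtain ⟨L, rfl, hL⟩ := Multiset.exists_map_eq_coe _ _ _ hMT
    rw [← Multiset.coe_flatten]
    refine ⟨?_, L.flatten, rfl, by rw [List.prod_flatten, hL, hl]⟩
    cases L with
    | nil => simp at hL; simp [← hL] at hT
    | cons a L =>
      have := hne' a (by simp)
      simp [this]
  obtain ⟨h1, h1'⟩ := key M₁ T₁ (fun b hb => hne b (Multiset.mem_add.mpr (Or.inl hb))) hM₁ h₁ hT₁
  obtain ⟨h2, h2'⟩ := key M₂ T₂ (fun b hb => hne b (Multiset.mem_add.mpr (Or.inr hb))) hM₂ h₂ hT₂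
  exact hS.2.2 ⟨_, _, h1, h2, by rw [hM, Multiset.map_add, Multiset.sum_add], h1', h2'⟩

theorem IsMinimalProductOne.infix_false {S : Multiset G} (hS : IsMinimalProductOne S)
    {p w s : List G} (hl : ((p ++ w ++ s : List G) : Multiset G) = S)
    (hl1 : (p ++ w ++ s).prod = 1) (hw1 : w.prod = 1) (hw : w ≠ []) (hps : p ++ s ≠ []) :
    False := by
  refine hS.2.2 ⟨w, (p ++ s : List G), by simpa using hw, by simpa using hps, ?_,
    IsProductOne.of_list hw1, IsProductOne.of_list ?_⟩
  · rw [← hl]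
    simp only [← Multiset.coe_add]
    abel
  · simpa [List.prod_append, hw1] using hl1

/-- Pigeonhole for partial products. -/
theorem List.exists_infix_prod_eq_one (H : Subgroup G) [Finite H] (l : List G)
    (hl : ∀ g ∈ l, g ∈ H) (hc : Nat.card H ≤ l.length) :
    ∃ p w s, l = p ++ w ++ s ∧ w ≠ [] ∧ w.prod = 1 ∧ w.length ≤ Nat.card H := by
  classical
  have hmem : ∀ i, (l.take i).prod ∈ H := fun i =>
    Subgroup.list_prod_mem _ fun g hg => hl g (List.mem_of_mem_take hg)
  let F : Fin (Nat.card H + 1) → H := fun i => ⟨(l.take i).prod, hmem i⟩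
  have hni : ¬ Function.Injective F := by
    intro hinj
    have := Nat.card_le_card_of_injective F hinj
    simp at this
  have : ∃ i j : Fin (Nat.card H + 1), i < j ∧ F i = F j := by
    simp only [Function.Injective, not_forall] at hni
    obtain ⟨i, j, h, hij⟩ := hni
    rcases lt_or_gt_of_ne hij with h' | h'
    · exact ⟨i, j, h', h⟩
    · exact ⟨j, i, h', h.symm⟩
  obtain ⟨i, j, hij, hF⟩ := this
  have hF' : (l.take i).prod = (l.take j).prod := congrArg Subtype.val hF
  have hj : (j : ℕ) ≤ l.length := by have := j.2; omega
  have hsplit : l.take j = l.take i ++ (l.take j).drop i := by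
    conv_lhs => rw [← List.take_append_drop i (l.take j)]
    rw [List.take_take, min_eq_left (by exact_mod_cast hij.le)]
  refine ⟨l.take i, (l.take j).drop i, l.drop j, ?_, ?_, ?_, ?_⟩
  · rw [← hsplit, List.take_append_drop]
  · intro h
    have := congrArg List.length h
    simp at this
    have hij' : (i : ℕ) < j := hij
    omega
  · rw [hsplit, List.prod_append] at hF'
    simpa using hF'
  · simp
    have := j.2
    omega

theorem Multiset.exists_le_isProductOne (H : Subgroup G) [Finite H] (T : Multiset G)
    (hT : ∀ g ∈ T, g ∈ H) (hc : Nat.card H ≤ card T) :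
    ∃ Z ≤ T, Z ≠ 0 ∧ IsProductOne Z ∧ card Z ≤ Nat.card H := by
  induction T using Quotient.inductionOn with | _ l
  obtain ⟨p, w, s, h, hw, hw1, hlen⟩ := List.exists_infix_prod_eq_one H l (by simpa using hT)
    (by simpa using hc)
  refine ⟨w, ?_, by simpa using hw, IsProductOne.of_list hw1, by simpa using hlen⟩
  change (w : Multiset G) ≤ (l : Multiset G)
  rw [h, Multiset.coe_le]
  exact (List.infix_append p w s).sublist.subperm

theorem IsMinimalProductOne.card_le_of_subgroup {S : Multiset G} (hS : IsMinimalProductOne S)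
    (H : Subgroup G) [Finite H] (hT : ∀ g ∈ S, g ∈ H) : Multiset.card S ≤ Nat.card H := by
  by_contra! hlt
  obtain ⟨l, rfl, hl1⟩ := hS.2.1
  simp at hlt
  obtain ⟨p, w, s, h, hw, hw1, hlen⟩ := List.exists_infix_prod_eq_one H l (by simpa using hT) hlt.le
  refine hS.infix_false (p := p) (w := w) (s := s) (by rw [h]) (by rw [← h, hl1]) hw1 hw ?_
  intro h0
  have : l.length = w.length := by
    have h1 := congrArg List.length h0
    rw [h]
    simp at h1 ⊢
    simp [h1]
  omega

theorem IsMinimalProductOne.sub_false {S : Multiset G} (hS : IsMinimalProductOne S)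
    {T Z : Multiset G} (h : S = T + Z) (hT : T ≠ 0) (hZ : Z ≠ 0) (hT1 : IsProductOne T)
    (hZ1 : IsProductOne Z) : False :=
  hS.2.2 ⟨T, Z, hT, hZ, h, hT1, hZ1⟩

/-- Every atom has length at most three quarters of the order. -/
def ShortAtoms (G : Type*) [Group G] : Prop :=
  ∀ S : Multiset G, IsMinimalProductOne S → 4 * Multiset.card S ≤ 3 * Nat.card G

theorem ShortAtoms.largeDavenport_le (h : ShortAtoms G) :
    4 * largeDavenport G ≤ 3 * Nat.card G := by
  have : largeDavenport G ≤ 3 * Nat.card G / 4 := by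
    apply csSup_le'
    rintro n ⟨S, rfl, hS⟩
    have := h S hS
    omega
  omega

/-- Cutting a list at the visits of its partial products to a coset. -/
theorem List.exists_blocks_of_visits (H : Subgroup G) [DecidablePred (· ∈ H)] (l : List G) :
    ∀ a : G, ∃ (p : List G) (bs : List (List G)), l = p ++ bs.flatten ∧
      bs.length = ((Finset.range l.length).filter (fun i => a * (l.take i).prod ∈ H)).card ∧
      (∀ b ∈ bs, b ≠ []) ∧ (bs ≠ [] → a * p.prod ∈ H) ∧ ∀ b ∈ bs.dropLast, b.prod ∈ H := by
  induction l with
  | nil => intro a; exact ⟨[], [], by simp⟩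
  | cons g l ih =>
    intro a
    obtain ⟨p, bs, hl, hlen, hne, hp, hb⟩ := ih (a * g)
    have hcount : ((Finset.range (g :: l).length).filter
        (fun i => a * ((g :: l).take i).prod ∈ H)).card =
        ((Finset.range l.length).filter (fun i => a * g * (l.take i).prod ∈ H)).card +
          if a ∈ H then 1 else 0 := by
      rw [Finset.card_filter, Finset.card_filter, List.length_cons, Finset.sum_range_succ']
      simp only [List.take_succ_cons, List.prod_cons, List.take_zero, List.prod_nil, mul_one,
        mul_assoc]
      congr!
    by_cases ha : a ∈ H
    · refine ⟨[], (g :: p) :: bs, by simp [hl], by rw [hcount]; simp [ha, hlen], ?_, by simpa, ?_⟩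
      · simpa using hne
      · cases bs with
        | nil => simp
        | cons b bs =>
          intro c hc
          rw [List.dropLast_cons_of_ne_nil (by simp)] at hc
          rcases List.mem_cons.mp hc with rfl | hc
          · have := hp (by simp)
            rw [mul_assoc, H.mul_mem_cancel_left ha] at this
            simpa using this
          · exact hb c hc
    · exact ⟨g :: p, bs, by simp [hl], by rw [hcount]; simp [ha, hlen], hne,
        fun h => by simpa [mul_assoc] using hp h, hb⟩

theorem ShortAtoms.of_injective {H : Type*} [Group H] [Finite G] (ι : H →* G)
    (hι : Function.Injective ι) (hH : ShortAtoms H) : ShortAtoms G := by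
  classical
  intro S hS
  obtain ⟨l, hlS, hl1⟩ := hS.2.1
  by_contra! hlt
  have hlen : Multiset.card S = l.length := by rw [← hlS]; simp
  rw [hlen] at hlt
  let R := ι.range
  have hcR : Nat.card R = Nat.card H := (Nat.card_congr (ι.ofInjective hι).toEquiv).symm
  have hcard : Nat.card G = Nat.card (G ⧸ R) * Nat.card H := by
    rw [Subgroup.card_eq_card_quotient_mul_card_subgroup R, hcR]
  let _ : Fintype (G ⧸ R) := Fintype.ofFinite _
  have : ∃ c : G ⧸ R, 3 * Nat.card H < 4 * ((Finset.range l.length).filter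
      (fun i => ((l.take i).prod : G ⧸ R) = c)).card := by
    by_contra! hcon
    have h1 := Finset.card_eq_sum_card_fiberwise (f := fun i => ((l.take i).prod : G ⧸ R))
      (s := Finset.range l.length) (t := Finset.univ) (by intro _ _; simp)
    have h2 := Finset.sum_le_sum (fun c (_ : c ∈ Finset.univ) => hcon c)
    rw [← Finset.mul_sum, ← h1] at h2
    simp only [Finset.card_range, Finset.sum_const, Finset.card_univ, smul_eq_mul] at h2
    rw [hcard, Nat.card_eq_fintype_card (α := G ⧸ R)] at hlt
    nlinarith
  obtain ⟨c, hc⟩ := this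
  obtain ⟨x, rfl⟩ := QuotientGroup.mk_surjective c
  obtain ⟨p, bs, hl, hbl, hne, hp, hb⟩ := List.exists_blocks_of_visits R l x⁻¹
  have hcnt : ((Finset.range l.length).filter (fun i => x⁻¹ * (l.take i).prod ∈ R)) =
      ((Finset.range l.length).filter (fun i => ((l.take i).prod : G ⧸ R) = x)) := by
    apply Finset.filter_congr
    intro i _
    rw [eq_comm, QuotientGroup.eq]
  rw [hcnt] at hbl
  have hbs : bs ≠ [] := by
    rintro rfl
    simp at hbl
    omega
  have hsplit := List.dropLast_append_getLast hbs
  set b₀ := bs.getLast hbs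
  set bs' := bs.dropLast ++ [b₀ ++ p]
  have hfl : bs'.flatten = bs.flatten ++ p := by
    conv_rhs => rw [← hsplit]
    simp [bs']
  have hprod : bs'.flatten.prod = 1 := by
    rw [hfl]
    apply List.prod_append_comm_eq_one
    rw [← hl, hl1]
  have hperm : (bs'.flatten : Multiset G) = S := by
    rw [hfl, ← hlS, hl, Multiset.coe_eq_coe]
    exact List.perm_append_comm
  have hmem : ∀ b ∈ bs', b.prod ∈ R := by
    intro b hb'
    rcases List.mem_append.mp hb' with h | h
    · exact hb b h
    · rw [List.mem_singleton] at h
      subst h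
      have h1 : (bs.dropLast.flatten).prod ∈ R := by
        rw [List.prod_flatten]
        apply Subgroup.list_prod_mem
        intro g hg
        obtain ⟨b, hb'', rfl⟩ := List.mem_map.mp hg
        exact hb b hb''
      have h2 : (bs.dropLast.flatten).prod * (b₀ ++ p).prod = 1 := by
        rw [← hprod]; simp [bs']
      rw [← R.mul_mem_cancel_left h1, h2]
      exact R.one_mem
  have hne' : ∀ b ∈ bs', b ≠ [] := by
    intro b hb'
    rcases List.mem_append.mp hb' with h | h
    · exact hne b (List.mem_of_mem_dropLast h)
    · rw [List.mem_singleton] at h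
      subst h
      have := hne b₀ (List.getLast_mem hbs)
      simp [this]
  have hlift : ∃ t : List H, t.map ι = bs'.map List.prod := by
    have : ∀ g ∈ bs'.map List.prod, g ∈ Set.range ι := by
      intro g hg
      obtain ⟨b, hb'', rfl⟩ := List.mem_map.mp hg
      exact hmem b hb''
    have := Set.range_list_map ι
    have h3 : bs'.map List.prod ∈ Set.range (List.map ι) := by
      rw [this]; assumption
    exact h3
  obtain ⟨t, ht⟩ := hlift
  have htlen : t.length = bs.length := by
    have h1 := congrArg List.length ht
    have h2 : bs.length = (bs.dropLast ++ [b₀]).length := by rw [hsplit]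
    simp [bs'] at h1 h2
    omega
  have ht1 : t.prod = 1 := by
    apply hι
    rw [map_list_prod, ht, ← List.prod_flatten, hprod, map_one]
  have hnat : ¬ IsMinimalProductOne (t : Multiset H) := by
    intro hmin
    have := hH _ hmin
    simp at this
    omega
  have ht0 : (t : Multiset H) ≠ 0 := by
    intro h
    simp at h
    simp [h] at htlen
    exact hbs (List.length_eq_zero_iff.mp htlen.symm)
  have hsp : ∃ T₁ T₂ : Multiset H, T₁ ≠ 0 ∧ T₂ ≠ 0 ∧ (t : Multiset H) = T₁ + T₂ ∧
      IsProductOne T₁ ∧ IsProductOne T₂ := by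
    by_contra hcon
    exact hnat ⟨ht0, IsProductOne.of_list ht1, hcon⟩
  obtain ⟨T₁, T₂, h1, h2, hadd, hT1, hT2⟩ := hsp
  have hmapone : ∀ T : Multiset H, IsProductOne T → IsProductOne (T.map ι) := by
    rintro T ⟨l', rfl, hl'⟩
    exact ⟨l'.map ι, by simp, by rw [← map_list_prod, hl', map_one]⟩
  refine hS.blocks_false (bs' : Multiset (List G)) (by simpa using hne') ?_ (T₁ := T₁.map ι)
    (T₂ := T₂.map ι) ?_ (by simpa using h1) (by simpa using h2) (hmapone _ hT1) (hmapone _ hT2)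
  · rw [← Multiset.coe_flatten, hperm]
  · rw [← Multiset.map_add, ← hadd, Multiset.map_coe, Multiset.map_coe, ht]

end Basic

/-- A group embedded in a semidirect product `ZMod q ⋊ K`, with `K` commutative acting through
a character: `f` is the (twisted) translation part and `ρ` the projection to `K`. -/
structure TwistedMap (G K : Type*) [Group G] [CommGroup K] (q : ℕ) where
  ρ : G →* K
  χ : G →* (ZMod q)ˣ
  f : G → ZMod q
  f_mul : ∀ g h, f (g * h) = f g + χ g * f h
  χ_eq_one : ∀ g, ρ g = 1 → χ g = 1
  eq_one : ∀ g, f g = 0 → ρ g = 1 → g = 1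

namespace TwistedMap

variable {G K : Type*} [Group G] [CommGroup K] {q : ℕ} (D : TwistedMap G K q)

theorem f_one : D.f 1 = 0 := by
  have := D.f_mul 1 1
  simpa using this

/-- Moving the fixed point to `p`. -/
def shift (p : ZMod q) : TwistedMap G K q where
  ρ := D.ρ
  χ := D.χ
  f g := D.f g - (1 - D.χ g) * p
  f_mul g h := by
    simp only [D.f_mul, map_mul, Units.val_mul]
    ring
  χ_eq_one := D.χ_eq_one
  eq_one g h1 h2 := D.eq_one g (by simpa [D.χ_eq_one g h2] using h1) h2

theorem f_inv (g : G) : D.f g⁻¹ = -((D.χ g)⁻¹ : (ZMod q)ˣ) * D.f g := by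
  have := D.f_mul g⁻¹ g
  simp only [inv_mul_cancel, f_one, map_inv] at this
  rw [neg_mul]
  exact eq_neg_of_add_eq_zero_left this.symm

theorem f_conj (p g : G) (hg : D.χ g = 1) :
    D.f (p⁻¹ * g * p) = ((D.χ p)⁻¹ : (ZMod q)ˣ) * D.f g := by
  rw [D.f_mul, D.f_mul, f_inv, map_mul, hg, mul_one, map_inv]
  ring

theorem f_mul_comm_iff (x y : G) :
    D.f (x * y) = D.f (y * x) ↔ D.f x * (1 - D.χ y) = D.f y * (1 - D.χ x) := by
  rw [D.f_mul, D.f_mul]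
  constructor
  · intro h; linear_combination h
  · intro h; linear_combination h

/-- The subgroup of elements with vanishing translation part. -/
def complement : Subgroup G where
  carrier := {g | D.f g = 0}
  mul_mem' {a b} ha hb := by
    simp only [Set.mem_ofPred_eq] at *
    rw [D.f_mul, ha, hb]; simp
  one_mem' := D.f_one
  inv_mem' {a} ha := by
    simp only [Set.mem_ofPred_eq] at *
    rw [D.f_inv, ha]; simp

@[simp] theorem mem_complement {g : G} : g ∈ D.complement ↔ D.f g = 0 := Iff.rfl

theorem complement_injective : Function.Injective (D.ρ.comp D.complement.subtype) := by
  rw [injective_iff_map_eq_one]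
  rintro ⟨g, hg⟩ h
  exact Subtype.ext (D.eq_one g hg h)

theorem card_complement_le [Finite K] : Nat.card D.complement ≤ Nat.card K :=
  Nat.card_le_card_of_injective _ D.complement_injective

theorem finite_complement [Finite K] : Finite D.complement :=
  Finite.of_injective _ D.complement_injective

theorem rho_prod {l : List G} {T : Multiset G} (h : (l : Multiset G) = T) :
    D.ρ l.prod = (T.map D.ρ).prod := by
  rw [← h, map_list_prod]; simp

theorem chi_prod {l : List G} {T : Multiset G} (h : (l : Multiset G) = T) :
    D.χ l.prod = (T.map D.χ).prod := by
  rw [← h, map_list_prod]; simp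

theorem rho_eq_one {D : TwistedMap G K q} {T : Multiset G} (h : IsProductOne T) : (T.map D.ρ).prod = 1 := by
  obtain ⟨l, hl, h1⟩ := h
  rw [← D.rho_prod hl, h1, map_one]

variable [Fact q.Prime]

open Classical in
/-- The translation parts of all orderings of the product of `T`. -/
noncomputable def values (T : Multiset G) : Finset (ZMod q) :=
  Finset.univ.filter (fun v => ∃ l : List G, (l : Multiset G) = T ∧ D.f l.prod = v)

variable {D}

@[simp] theorem mem_values {T : Multiset G} {v : ZMod q} :
    v ∈ D.values T ↔ ∃ l : List G, (l : Multiset G) = T ∧ D.f l.prod = v := by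
  simp [values]

theorem values_coe_mem (l : List G) : D.f l.prod ∈ D.values (l : Multiset G) :=
  mem_values.mpr ⟨l, rfl, rfl⟩

theorem values_nonempty (T : Multiset G) : (D.values T).Nonempty := by
  induction T using Quotient.inductionOn with | _ l
  exact ⟨_, values_coe_mem l⟩

theorem isProductOne_of_zero_mem {T : Multiset G} (h : 0 ∈ D.values T)
    (hρ : (T.map D.ρ).prod = 1) : IsProductOne T := by
  obtain ⟨l, hl, h0⟩ := mem_values.mp h
  exact ⟨l, hl, D.eq_one _ h0 (by rw [D.rho_prod hl, hρ])⟩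

/-- The orderings of `T` yield at least `n + 1` translation parts, or all of them. -/
def Spread (D : TwistedMap G K q) (T : Multiset G) (n : ℕ) : Prop :=
  min q (n + 1) ≤ (D.values T).card

theorem Spread.zero (T : Multiset G) : D.Spread T 0 := by
  have := (values_nonempty (D := D) T).card_pos
  unfold Spread
  omega

theorem Spread.mono {T : Multiset G} {n m : ℕ} (h : D.Spread T n) (hm : m ≤ n) :
    D.Spread T m := by
  unfold Spread at *
  omega

theorem f_mem_values_add {T₁ T₂ : Multiset G} {v w : ZMod q} (h₁ : v ∈ D.values T₁)
    (h₂ : w ∈ D.values T₂) : v + (T₁.map D.χ).prod * w ∈ D.values (T₁ + T₂) := by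
  obtain ⟨l₁, h1, rfl⟩ := mem_values.mp h₁
  obtain ⟨l₂, h2, rfl⟩ := mem_values.mp h₂
  refine mem_values.mpr ⟨l₁ ++ l₂, by rw [← h1, ← h2]; rfl, ?_⟩
  rw [List.prod_append, D.f_mul, D.chi_prod h1]

open scoped Pointwise in
theorem Spread.add {T₁ T₂ : Multiset G} {n₁ n₂ : ℕ} (h₁ : D.Spread T₁ n₁) (h₂ : D.Spread T₂ n₂) :
    D.Spread (T₁ + T₂) (n₁ + n₂) := by
  unfold Spread at *
  set u := (T₁.map D.χ).prod
  have hcard : ((D.values T₂).image (fun w => (u : ZMod q) * w)).card = (D.values T₂).card :=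
    Finset.card_image_of_injective _ (fun a b h => by simpa using h)
  have hcd := ZMod.cauchy_davenport (Fact.out : q.Prime) (values_nonempty (D := D) T₁)
    ((values_nonempty (D := D) T₂).image (fun w => (u : ZMod q) * w))
  rw [hcard] at hcd
  have hsub : D.values T₁ + (D.values T₂).image (fun w => (u : ZMod q) * w) ⊆
      D.values (T₁ + T₂) := by
    intro v hv
    obtain ⟨a, ha, b, hb, rfl⟩ := Finset.mem_add.mp hv
    obtain ⟨w, hw, rfl⟩ := Finset.mem_image.mp hb
    exact f_mem_values_add ha hw
  have := Finset.card_le_card hsub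
  have hp := (values_nonempty (D := D) T₁).card_pos
  have hp' := (values_nonempty (D := D) T₂).card_pos
  omega

theorem Spread.mono_left {T T' : Multiset G} {n : ℕ} (h : D.Spread T n) (hT : T ≤ T') :
    D.Spread T' n := by
  obtain ⟨U, rfl⟩ := Multiset.le_iff_exists_add.mp hT
  simpa using h.add (Spread.zero U)

theorem Spread.of_injOn {T : Multiset G} {α : Type*} (s : Finset α) (F : α → ZMod q) {n : ℕ}
    (hinj : Set.InjOn F s) (hF : ∀ a ∈ s, F a ∈ D.values T) (hn : n + 1 ≤ s.card) :
    D.Spread T n := by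
  have := Finset.card_le_card_of_injOn F hF hinj
  unfold Spread
  omega

theorem Spread.of_list {T : Multiset G} (L : List (ZMod q)) (hL : L.Nodup)
    (h : ∀ v ∈ L, v ∈ D.values T) {n : ℕ} (hn : n + 1 ≤ L.length) : D.Spread T n := by
  classical
  refine Spread.of_injOn L.toFinset id (Set.injOn_id _) (by simpa using h) ?_
  rwa [List.toFinset_card_of_nodup hL]

theorem Spread.pair {x y : G} (h : D.f (x * y) ≠ D.f (y * x)) : D.Spread {x, y} 1 := by
  refine Spread.of_list [D.f (x * y), D.f (y * x)] (by simpa using h) ?_ (by simp)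
  intro v hv
  simp only [List.mem_cons, List.not_mem_nil, or_false] at hv
  rcases hv with rfl | rfl
  · have := values_coe_mem (D := D) [x, y]
    rwa [List.prod_pair] at this
  · have := values_coe_mem (D := D) [y, x]
    have hc : (([y, x] : List G) : Multiset G) = {x, y} := Multiset.pair_comm y x
    rwa [hc, List.prod_pair] at this

open scoped Pointwise in
theorem Spread.cons {T : Multiset G} {n : ℕ} {a : G} (h : D.Spread T n) (ha : D.χ a = 1)
    (ha0 : D.f a ≠ 0) (hT : (T.map D.χ).prod ≠ 1) : D.Spread (a ::ₘ T) (n + 1) := by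
  classical
  unfold Spread at *
  set u := (T.map D.χ).prod
  have hne : D.f a ≠ u * D.f a := by
    intro h
    have h2 : ((u : ZMod q) - 1) * D.f a = 0 := by linear_combination -h
    rcases mul_eq_zero.mp h2 with h | h
    · exact hT (Units.ext (by simpa using sub_eq_zero.mp h))
    · exact ha0 h
  have hcd := ZMod.cauchy_davenport (Fact.out : q.Prime) (values_nonempty (D := D) T)
    (t := {D.f a, u * D.f a}) (by simp)
  rw [Finset.card_pair hne] at hcd
  have hsub : D.values T + {D.f a, u * D.f a} ⊆ D.values (a ::ₘ T) := by
    intro v hv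
    obtain ⟨w, hw, b, hb, rfl⟩ := Finset.mem_add.mp hv
    have ha' : D.f a ∈ D.values {a} := by simp
    rw [Finset.mem_insert, Finset.mem_singleton] at hb
    rcases hb with rfl | rfl
    · have := f_mem_values_add ha' hw
      rw [← Multiset.singleton_add, add_comm w]
      simpa [ha] using this
    · have := f_mem_values_add hw ha'
      rwa [add_comm, Multiset.singleton_add] at this
  have := Finset.card_le_card hsub
  omega

/-- A part of an atom reaching every translation part is disjoint from product-one parts. -/
theorem Spread.false {S : Multiset G} (hS : IsMinimalProductOne S) {T Z : Multiset G} {n : ℕ}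
    (hT : D.Spread T n) (hn : q ≤ n + 1) (hle : T + Z ≤ S) (hZ : Z ≠ 0) (hZ1 : IsProductOne Z)
    (hT0 : T ≠ 0) : False := by
  obtain ⟨R, rfl⟩ := Multiset.le_iff_exists_add.mp hle
  have hfull : D.Spread (T + R) n := hT.mono_left (Multiset.le_add_right _ _)
  have huniv : D.values (T + R) = Finset.univ := by
    apply Finset.eq_univ_of_card
    rw [ZMod.card]
    have : (D.values (T + R)).card ≤ q := by
      simpa [ZMod.card] using Finset.card_le_univ (D.values (T + R))
    unfold Spread at hfull
    omega
  refine hS.sub_false (T := T + R) (Z := Z) (by abel) (by simp [hT0]) hZ ?_ hZ1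
  refine isProductOne_of_zero_mem (D := D) (by simp [huniv]) ?_
  have h1 := rho_eq_one (D := D) hS.2.1
  have h2 := rho_eq_one (D := D) hZ1
  simp only [Multiset.map_add, Multiset.prod_add] at h1 ⊢
  rw [h2] at h1
  simpa using h1

open Classical in
/-- The common fixed point of the cyclic group generated by `g`, if there is just one. -/
noncomputable def fixedPoint (D : TwistedMap G K q) (g : G) : Option (ZMod q) :=
  if D.χ g = 1 then none else some (D.f g / (1 - D.χ g))

theorem one_sub_chi_ne_zero {g : G} (h : D.χ g ≠ 1) : (1 : ZMod q) - D.χ g ≠ 0 := by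
  intro h0
  exact h (Units.ext (by simpa using (sub_eq_zero.mp h0).symm))

theorem fixedPoint_eq_some_iff {g : G} {p : ZMod q} :
    D.fixedPoint g = some p ↔ D.χ g ≠ 1 ∧ (D.shift p).f g = 0 := by
  unfold fixedPoint shift
  by_cases h : D.χ g = 1
  · simp [h]
  · have := one_sub_chi_ne_zero h
    simp only [h, if_false, Option.some.injEq, ne_eq, not_false_eq_true, true_and]
    rw [div_eq_iff this, sub_eq_zero, mul_comm p]

theorem fixedPoint_eq_none_iff {g : G} : D.fixedPoint g = none ↔ D.χ g = 1 := by
  unfold fixedPoint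
  split_ifs <;> simpa

theorem f_mul_ne_of_fixedPoint_ne {x y : G} (hx : D.χ x = 1 → D.f x ≠ 0)
    (hy : D.χ y = 1 → D.f y ≠ 0) (h : D.fixedPoint x ≠ D.fixedPoint y) :
    D.f (x * y) ≠ D.f (y * x) := by
  rw [Ne, f_mul_comm_iff]
  intro he
  by_cases h1 : D.χ x = 1
  · by_cases h2 : D.χ y = 1
    · exact h (by rw [fixedPoint_eq_none_iff.mpr h1, fixedPoint_eq_none_iff.mpr h2])
    · have := one_sub_chi_ne_zero h2
      simp only [h1, Units.val_one, sub_self, mul_zero, mul_eq_zero] at he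
      exact he.elim (hx h1) this
  · have h3 := one_sub_chi_ne_zero h1
    by_cases h2 : D.χ y = 1
    · simp only [h2, Units.val_one, sub_self, mul_zero, zero_eq_mul] at he
      exact he.elim (hy h2) h3
    · have h4 := one_sub_chi_ne_zero h2
      apply h
      simp only [fixedPoint, h1, h2, if_false, Option.some.injEq]
      rw [div_eq_div_iff h3 h4, he]

end TwistedMap

/-- A multiset with no dominating class contains many disjoint pairs of distinct classes. -/
theorem Multiset.exists_matching {α β : Type*} [DecidableEq β] (κ : α → β) (s : ℕ) :
    ∀ V : Multiset α, 2 * s ≤ card V → (∀ b, s ≤ V.countP (fun x => κ x ≠ b)) →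
      ∃ P : Multiset (α × α), card P = s ∧ (∀ p ∈ P, κ p.1 ≠ κ p.2) ∧
        P.map Prod.fst + P.map Prod.snd ≤ V := by
  classical
  induction s with
  | zero => intro V _ _; exact ⟨0, by simp⟩
  | succ s ih =>
    intro V hV hout
    have hne : V ≠ 0 := by
      rintro rfl; simp at hV
    obtain ⟨x, hx, hmax⟩ := V.toFinset.exists_max_image (fun x => V.countP (fun y => κ y = κ x))
      (by simpa using hne)
    have hx : x ∈ V := by simpa using hx
    have hpos : 0 < V.countP (fun y => κ y ≠ κ x) := by have := hout (κ x); omega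
    obtain ⟨y, hy, hyx⟩ := Multiset.countP_pos.mp hpos
    have hxy : x ≠ y := by rintro rfl; exact hyx rfl
    obtain ⟨V', hV'⟩ := Multiset.exists_cons_of_mem hx
    have hy' : y ∈ V' := by
      rw [hV', Multiset.mem_cons] at hy
      exact hy.resolve_left (Ne.symm hxy)
    obtain ⟨V'', hV''⟩ := Multiset.exists_cons_of_mem hy'
    have hVeq : V = x ::ₘ y ::ₘ V'' := by rw [hV', hV'']
    have hcompl : ∀ b, V.countP (fun z => κ z = b) + V.countP (fun z => κ z ≠ b) = card V :=
      fun b => (Multiset.card_eq_countP_add_countP _ _).symm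
    obtain ⟨P, hP, hPne, hPle⟩ := ih V'' (by simp [hVeq] at hV; omega) (by
      intro b
      have ho := hout b
      have hcnt : V.countP (fun z => κ z ≠ b) = V''.countP (fun z => κ z ≠ b) +
          (if κ y ≠ b then 1 else 0) + (if κ x ≠ b then 1 else 0) := by
        rw [hVeq, Multiset.countP_cons, Multiset.countP_cons]
      by_cases hbx : κ x = b
      · rw [if_neg (not_not.mpr hbx)] at hcnt
        split_ifs at hcnt <;> omega
      by_cases hby : κ y = b
      · rw [if_neg (not_not.mpr hby)] at hcnt
        split_ifs at hcnt <;> omega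
      rw [if_pos hbx, if_pos hby] at hcnt
      by_contra! hlt
      have h1 := hcompl b
      have h2 : 0 < V.countP (fun z => κ z = b) := by omega
      obtain ⟨z, hz, rfl⟩ := Multiset.countP_pos.mp h2
      have h3 := hmax z (by simpa using hz)
      have h4 : V.countP (fun w => κ w = κ x) + V.countP (fun w => κ w = κ y) ≤
          V.countP (fun w => κ w ≠ κ z) := by
        have e1 : V.countP (fun w => κ w = κ y) =
            (V.filter (fun w => κ w ≠ κ z)).countP (fun w => κ w = κ y) := by
          rw [Multiset.countP_filter]
          exact Multiset.countP_congr rfl (by intro w _; grind)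
        have e2 : V.countP (fun w => κ w = κ x) ≤
            (V.filter (fun w => κ w ≠ κ z)).countP (fun w => ¬ κ w = κ y) := by
          rw [Multiset.countP_filter]
          simp only [Multiset.countP_eq_card_filter]
          apply Multiset.card_le_card
          apply Multiset.monotone_filter_right
          intro w hw
          grind
        have e3 := Multiset.card_eq_countP_add_countP (fun w => κ w = κ y)
          (V.filter (fun w => κ w ≠ κ z))
        rw [← Multiset.countP_eq_card_filter] at e3
        omega
      have h5 : 0 < V.countP (fun w => κ w = κ y) := Multiset.countP_pos.mpr ⟨y, hy, rfl⟩
      omega)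
    refine ⟨(x, y) ::ₘ P, by simp [hP], ?_, ?_⟩
    · intro p hp
      rcases Multiset.mem_cons.mp hp with rfl | hp
      · exact Ne.symm hyx
      · exact hPne p hp
    · rw [hVeq, Multiset.map_cons, Multiset.map_cons, Multiset.cons_add, Multiset.add_cons]
      exact Multiset.cons_le_cons _ (Multiset.cons_le_cons _ hPle)

namespace TwistedMap

variable {G K : Type*} [Group G] [CommGroup K] {q : ℕ} {D : TwistedMap G K q}

theorem exists_infix_rho_eq_one [Finite K] (l : List G) (hl : Nat.card K ≤ l.length) :
    ∃ p w s, l = p ++ w ++ s ∧ w ≠ [] ∧ D.ρ w.prod = 1 := by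
  obtain ⟨p, w, s, h, hw, hw1, -⟩ := List.exists_infix_prod_eq_one (⊤ : Subgroup K) (l.map D.ρ)
    (by simp) (by simpa using hl)
  obtain ⟨t, s', rfl, ht, rfl⟩ := List.map_eq_append_iff.mp h
  obtain ⟨p', w', rfl, rfl, rfl⟩ := List.map_eq_append_iff.mp ht
  exact ⟨p', w', s', rfl, by simpa using hw, by rw [map_list_prod, hw1]⟩

theorem shift_f_mul_ne_iff (p : ZMod q) (x y : G) :
    (D.shift p).f (x * y) ≠ (D.shift p).f (y * x) ↔ D.f (x * y) ≠ D.f (y * x) := by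
  simp [shift, mul_comm]

theorem chi_pow_three (hK : Nat.card K = 3) (g : G) : D.χ g ^ 3 = 1 := by
  rw [← map_pow]
  apply D.χ_eq_one
  rw [map_pow, ← hK, pow_card_eq_one']

variable [Fact q.Prime]

theorem Spread.of_pairs (P : Multiset (G × G)) (hP : ∀ p ∈ P, D.f (p.1 * p.2) ≠ D.f (p.2 * p.1)) :
    D.Spread (P.map Prod.fst + P.map Prod.snd) (Multiset.card P) := by
  induction P using Multiset.induction_on with
  | empty => exact Spread.zero _
  | cons p P ih =>
    have h1 := Spread.pair (hP p (by simp))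
    have h2 := ih (fun p' hp' => hP p' (by simp [hp']))
    have h3 := h2.add h1
    convert h3 using 1
    · rw [Multiset.map_cons, Multiset.map_cons, Multiset.insert_eq_cons]
      simp only [← Multiset.singleton_add]
      abel
    · simp

theorem exists_spread_of_matching (s : ℕ) (V : Multiset G) (hV : ∀ x ∈ V, D.χ x = 1 → D.f x ≠ 0)
    (hs : 2 * s ≤ Multiset.card V)
    (hout : ∀ b, s ≤ V.countP (fun x => D.fixedPoint x ≠ b)) :
    ∃ T ≤ V, Multiset.card T = 2 * s ∧ D.Spread T s := by
  obtain ⟨P, hP, hne, hle⟩ := Multiset.exists_matching D.fixedPoint s V hs hout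
  refine ⟨_, hle, by simp [hP]; ring, ?_⟩
  rw [← hP]
  apply Spread.of_pairs
  intro p hp
  refine f_mul_ne_of_fixedPoint_ne (hV _ ?_) (hV _ ?_) (hne p hp)
  · exact Multiset.mem_of_le hle (Multiset.mem_add.mpr (Or.inl (Multiset.mem_map_of_mem _ hp)))
  · exact Multiset.mem_of_le hle (Multiset.mem_add.mpr (Or.inr (Multiset.mem_map_of_mem _ hp)))

/-- An outside term together with translations. -/
theorem Spread.of_translations {x : G} (hx : D.χ x ≠ 1) (A : Multiset G)
    (hA : ∀ a ∈ A, D.χ a = 1 ∧ D.f a ≠ 0) : D.Spread (A + {x}) (Multiset.card A) := by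
  induction A using Multiset.induction_on with
  | empty => exact Spread.zero _
  | cons a A ih =>
    have h2 := ih (fun p' hp' => hA p' (by simp [hp']))
    have h3 := hA a (by simp)
    rw [Multiset.cons_add, Multiset.card_cons]
    refine h2.cons h3.1 h3.2 ?_
    have : (A.map D.χ) = A.map (fun _ => 1) :=
      Multiset.map_congr rfl (fun a ha => (hA a (by simp [ha])).1)
    rw [Multiset.map_add, Multiset.prod_add, this]
    simpa using hx

open Classical in
/-- Translation parts of the translations that are products of subsequences of `W`. -/
noncomputable def subValues (D : TwistedMap G K q) (W : Multiset G) : Finset (ZMod q) :=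
  Finset.univ.filter
    (fun v => ∃ l : List G, (l : Multiset G) ≤ W ∧ D.χ l.prod = 1 ∧ D.f l.prod = v)

theorem mem_subValues {W : Multiset G} {v : ZMod q} : v ∈ D.subValues W ↔
    ∃ l : List G, (l : Multiset G) ≤ W ∧ D.χ l.prod = 1 ∧ D.f l.prod = v := by
  simp [subValues]

theorem zero_mem_subValues (W : Multiset G) : 0 ∈ D.subValues W :=
  mem_subValues.mpr ⟨[], by simp, by simp, by simp [f_one]⟩

open scoped Pointwise in
theorem card_add_two_le_of_free [Finite K] (hfaith : ∀ g, D.χ g = 1 → D.ρ g = 1) (n : ℕ) :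
    ∀ W : Multiset G, Multiset.card W = n → (∀ Z ≤ W, Z ≠ 0 → ¬ IsProductOne Z) →
      n + 2 ≤ (D.subValues W).card + Nat.card K := by
  classical
  induction n using Nat.strong_induction_on with | _ n ih
  intro W hW hfree
  have hone : ∀ l : List G, l ≠ [] → (l : Multiset G) ≤ W → D.χ l.prod = 1 → D.f l.prod ≠ 0 := by
    intro l hl hle h1 h0
    exact hfree l hle (by simpa using hl) ⟨l, rfl, D.eq_one _ h0 (hfaith _ h1)⟩
  have hKpos : 0 < Nat.card K := Nat.card_pos
  rcases lt_or_ge n (Nat.card K) with hlt | hge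
  · have := Finset.card_pos.mpr ⟨_, zero_mem_subValues (D := D) W⟩
    omega
  have hex : ∃ j, ∃ w : List G, w.length = j ∧ (w : Multiset G) ≤ W ∧ w ≠ [] ∧
      D.χ w.prod = 1 := by
    obtain ⟨l, rfl⟩ := Quot.exists_rep W
    obtain ⟨p, w, s, rfl, hw, hw1⟩ := exists_infix_rho_eq_one (D := D) l (by
      have : l.length = n := by simpa using hW
      omega)
    refine ⟨_, w, rfl, ?_, hw, D.χ_eq_one _ hw1⟩
    exact Multiset.coe_le.mpr (List.infix_append p w s).sublist.subperm
  obtain ⟨w, hwj, hwW, hw0, hw1⟩ := Nat.find_spec hex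
  have hmin : ∀ v : List G, (v : Multiset G) ≤ W → v ≠ [] → D.χ v.prod = 1 →
      w.length ≤ v.length := by
    intro v h1 h2 h3
    rw [hwj]
    exact Nat.find_min' hex ⟨v, rfl, h1, h2, h3⟩
  obtain ⟨W', rfl⟩ := Multiset.le_iff_exists_add.mp hwW
  have hjpos : 0 < w.length := List.length_pos_iff.mpr hw0
  have hcW : w.length + Multiset.card W' = n := by simpa using hW
  have hIH := ih _ (by omega) W' rfl (fun Z hZ =>
    hfree Z (hZ.trans (Multiset.le_add_left _ _)))
  have hrotperm : ∀ i, ((w.rotate i : List G) : Multiset G) = w := fun i =>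
    Multiset.coe_eq_coe.mpr (List.rotate_perm w i)
  have hroteq : ∀ i ≤ w.length, (w.rotate i).prod =
      (w.take i).prod⁻¹ * w.prod * (w.take i).prod := by
    intro i hi
    rw [List.rotate_eq_drop_append_take hi, List.prod_append]
    conv_rhs => rw [← List.prod_take_mul_prod_drop w i]
    group
  have hrotf : ∀ i ≤ w.length, D.f (w.rotate i).prod =
      ((D.χ (w.take i).prod)⁻¹ : (ZMod q)ˣ) * D.f w.prod := by
    intro i hi
    rw [hroteq i hi, f_conj _ _ _ hw1]
  have hrotχ : ∀ i ≤ w.length, D.χ (w.rotate i).prod = 1 := by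
    intro i hi
    rw [hroteq i hi, map_mul, map_mul, hw1, map_inv]
    simp
  have hfw : D.f w.prod ≠ 0 := hone w hw0 hwW hw1
  have hlt_ne : ∀ i j : ℕ, i < j → j < w.length →
      D.f (w.rotate i).prod ≠ D.f (w.rotate j).prod := by
    intro i j hij hj he
    rw [hrotf i (by omega), hrotf j (by omega)] at he
    have he' := Units.ext (mul_right_cancel₀ hfw he)
    rw [inv_inj] at he'
    have hsplit : w.take j = w.take i ++ (w.take j).drop i := by
      conv_lhs => rw [← List.take_append_drop i (w.take j)]
      rw [List.take_take, min_eq_left hij.le]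
    rw [hsplit, List.prod_append, map_mul, left_eq_mul] at he'
    have hlen : ((w.take j).drop i).length = j - i := by
      simp; omega
    have h2 := hmin ((w.take j).drop i) (le_trans (Multiset.coe_le.mpr
      (((List.drop_sublist _ _).trans (List.take_sublist _ _)).subperm)) hwW) (by
        intro h
        rw [h] at hlen
        simp at hlen
        omega) he'
    omega
  let X : Finset (ZMod q) := (Finset.range w.length).image (fun i => D.f (w.rotate i).prod)
  have hXcard : X.card = w.length := by
    rw [Finset.card_image_of_injOn, Finset.card_range]
    intro i hi j hj h
    simp only [Finset.coe_range, Set.mem_Iio] at hi hj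
    rcases lt_trichotomy i j with h' | h' | h'
    · exact absurd h (hlt_ne i j h' hj)
    · exact h'
    · exact absurd h.symm (hlt_ne j i h' hi)
  have hX : ∀ v ∈ X, ∃ i ≤ w.length, D.f (w.rotate i).prod = v := by
    intro v hv
    obtain ⟨i, hi, rfl⟩ := Finset.mem_image.mp hv
    exact ⟨i, (Finset.mem_range.mp hi).le, rfl⟩
  have hrotne : ∀ i, w.rotate i ≠ [] := by
    intro i h
    exact hw0 (List.rotate_eq_nil_iff.mp h)
  have h0X : 0 ∉ X := by
    intro h
    obtain ⟨i, hi, h0⟩ := hX 0 h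
    exact hone (w.rotate i) (hrotne i) (by rwa [hrotperm]) (hrotχ i hi) h0
  have hdisj : Disjoint (D.subValues W') (X.image (fun v => -v)) := by
    rw [Finset.disjoint_left]
    intro v hv hv'
    obtain ⟨u, hu, rfl⟩ := Finset.mem_image.mp hv'
    obtain ⟨i, hi, rfl⟩ := hX u hu
    obtain ⟨l, hl, hl1, hlf⟩ := mem_subValues.mp hv
    refine hone (w.rotate i ++ l) (by simp [hw0]) ?_ ?_ ?_
    · rw [← Multiset.coe_add, hrotperm]
      exact add_le_add_right hl _
    · rw [List.prod_append, map_mul, hrotχ i hi, hl1, one_mul]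
    · rw [List.prod_append, D.f_mul, hrotχ i hi, hlf]
      simp
  have hsum : (D.subValues W').card + w.length ≤ q := by
    have h1 := Finset.card_le_univ (D.subValues W' ∪ X.image (fun v => -v))
    rw [Finset.card_union_of_disjoint hdisj, Finset.card_image_of_injective _ neg_injective,
      hXcard, ZMod.card] at h1
    exact h1
  have hsub : insert 0 X + D.subValues W' ⊆ D.subValues (w + W') := by
    intro v hv
    obtain ⟨a, ha, b, hb, rfl⟩ := Finset.mem_add.mp hv
    obtain ⟨l, hl, hl1, rfl⟩ := mem_subValues.mp hb
    rcases Finset.mem_insert.mp ha with rfl | ha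
    · exact mem_subValues.mpr ⟨l, hl.trans (Multiset.le_add_left _ _), hl1, by simp⟩
    · obtain ⟨i, hi, rfl⟩ := hX a ha
      refine mem_subValues.mpr ⟨w.rotate i ++ l, ?_, ?_, ?_⟩
      · rw [← Multiset.coe_add, hrotperm]
        exact add_le_add_right hl _
      · rw [List.prod_append, map_mul, hrotχ i hi, hl1, one_mul]
      · rw [List.prod_append, D.f_mul, hrotχ i hi]
        simp
  have hcd := ZMod.cauchy_davenport (Fact.out : q.Prime) (Finset.insert_nonempty 0 X)
    ⟨0, zero_mem_subValues (D := D) W'⟩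
  rw [Finset.card_insert_of_notMem h0X, hXcard] at hcd
  have := Finset.card_le_card hsub
  omega

/-- Upper bound for the small Davenport constant of a metacyclic Frobenius group. -/
theorem exists_le_isProductOne_of_card [Finite K] (hfaith : ∀ g, D.χ g = 1 → D.ρ g = 1)
    (W : Multiset G) (hW : q + Nat.card K ≤ Multiset.card W + 1) :
    ∃ Z ≤ W, Z ≠ 0 ∧ IsProductOne Z := by
  by_contra! hcon
  have h1 := card_add_two_le_of_free hfaith _ W rfl hcon
  have h2 : (D.subValues W).card ≤ q := by
    simpa [ZMod.card] using Finset.card_le_univ (D.subValues W)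
  omega

theorem _root_.List.exists_append_countP_eq {α : Type*} (p : α → Bool) (l : List α) (n : ℕ)
    (hn : n ≤ l.countP p) : ∃ l₁ l₂, l = l₁ ++ l₂ ∧ l₁.countP p = n := by
  induction l generalizing n with
  | nil => exact ⟨[], [], rfl, by simpa using hn.antisymm' (by simp)⟩
  | cons a l ih =>
    cases n with
    | zero => exact ⟨[], a :: l, rfl, rfl⟩
    | succ n =>
      by_cases ha : p a
      · obtain ⟨l₁, l₂, rfl, h⟩ := ih n (by simpa [ha] using hn)
        exact ⟨a :: l₁, l₂, rfl, by simp [ha, h]⟩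
      · obtain ⟨l₁, l₂, rfl, h⟩ := ih (n + 1) (by simpa [ha] using hn)
        exact ⟨a :: l₁, l₂, rfl, by simp [ha, h]⟩

/-- A term outside a complement followed by terms from the complement. -/
theorem Spread.of_cons_complement (hfaith : ∀ g, D.χ g = 1 → D.ρ g = 1) {c : G}
    (hc : D.f c ≠ 0) (w : List G) (hw : ∀ g ∈ w, D.f g = 0)
    (hfree : ∀ v : List G, v <:+: w → v ≠ [] → v.prod ≠ 1) :
    D.Spread ((c :: w : List G) : Multiset G) w.length := by
  have hf0 : ∀ v : List G, v.Sublist w → D.f v.prod = 0 := by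
    intro v hv
    have : v.prod ∈ D.complement := Subgroup.list_prod_mem _ (fun g hg => hw g (hv.subset hg))
    exact this
  have hlt : ∀ i j : ℕ, i < j → j ≤ w.length → D.χ (w.take i).prod ≠ D.χ (w.take j).prod := by
    intro i j hij hj he
    have hsplit : w.take j = w.take i ++ (w.take j).drop i := by
      conv_lhs => rw [← List.take_append_drop i (w.take j)]
      rw [List.take_take, min_eq_left hij.le]
    rw [hsplit, List.prod_append, map_mul, left_eq_mul] at he
    have hlen : ((w.take j).drop i).length = j - i := by
      simp; omega
    refine hfree ((w.take j).drop i) ?_ ?_ (D.eq_one _ (hf0 _ ?_) (hfaith _ he))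
    · exact (List.drop_suffix _ _).isInfix.trans (List.take_prefix _ _).isInfix
    · intro h
      rw [h] at hlen
      simp at hlen
      omega
    · exact (List.drop_sublist _ _).trans (List.take_sublist _ _)
  refine Spread.of_injOn (Finset.range (w.length + 1))
    (fun i => D.f (w.take i ++ c :: w.drop i).prod) ?_ ?_ (by simp)
  · have hval : ∀ i, D.f (w.take i ++ c :: w.drop i).prod = D.χ (w.take i).prod * D.f c := by
      intro i
      rw [List.prod_append, List.prod_cons, D.f_mul, D.f_mul, hf0 _ (List.take_sublist _ _),
        hf0 _ (List.drop_sublist _ _)]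
      ring
    intro i hi j hj h
    simp only [Finset.coe_range, Set.mem_Iio] at hi hj
    simp only [hval] at h
    have h' := Units.ext (mul_right_cancel₀ hc h)
    rcases lt_trichotomy i j with h'' | h'' | h''
    · exact absurd h' (hlt i j h'' (by omega))
    · exact h''
    · exact absurd h'.symm (hlt j i h'' (by omega))
  · intro i _
    refine mem_values.mpr ⟨_, ?_, rfl⟩
    rw [Multiset.coe_eq_coe]
    refine List.perm_middle.trans ?_
    rw [List.take_append_drop]

theorem Spread.of_list_complement (hfaith : ∀ g, D.χ g = 1 → D.ρ g = 1) (n : ℕ) :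
    ∀ l : List G, l.length = n → (∀ c ∈ l.head?, D.f c ≠ 0) →
    (∀ v : List G, v <:+: l → v ≠ [] → (∀ g ∈ v, D.f g = 0) → v.prod ≠ 1) →
    D.Spread (l : Multiset G) (l.countP (fun g => D.f g = 0)) := by
  induction n using Nat.strong_induction_on with | _ n ih
  intro l hl hhead hfree
  cases l with
  | nil => exact Spread.zero _
  | cons c t =>
    have hc : D.f c ≠ 0 := hhead c (by simp)
    set w := t.takeWhile (fun g => D.f g = 0) with hwdef
    set r := t.dropWhile (fun g => D.f g = 0) with hrdef
    have ht : t = w ++ r := (List.takeWhile_append_dropWhile).symm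
    have hw : ∀ g ∈ w, D.f g = 0 := by
      intro g hg
      have := List.mem_takeWhile_imp hg
      simpa using this
    have h1 : D.Spread ((c :: w : List G) : Multiset G) w.length := by
      refine Spread.of_cons_complement hfaith hc w hw (fun v hv hv0 => hfree v ?_ hv0 ?_)
      · rw [ht]
        exact (hv.trans (List.prefix_append w r).isInfix).trans (List.suffix_cons _ _).isInfix
      · intro g hg
        exact hw g (hv.subset hg)
    have h2 := ih r.length (by
      rw [← hl, ht]; simp) r rfl (by
        intro g hg
        have := List.head?_dropWhile_not (fun g => decide (D.f g = 0)) t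
        rw [← hrdef] at this
        rw [Option.mem_def] at hg
        rw [hg] at this
        simpa using this) (by
        intro v hv
        apply hfree
        rw [ht]
        exact (hv.trans (List.suffix_append w r).isInfix).trans (List.suffix_cons _ _).isInfix)
    have h3 := h1.add h2
    have hcw : w.countP (fun g => D.f g = 0) = w.length :=
      List.countP_eq_length.mpr (by simpa using hw)
    have e : (c :: t).countP (fun g => D.f g = 0) =
        w.length + r.countP (fun g => D.f g = 0) := by
      rw [List.countP_cons, ht, List.countP_append, hcw]
      simp [hc]
    rw [e]
    convert h3 using 1
    rw [ht]
    simp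

/-- A complement contains few terms of an atom. -/
theorem countP_complement_le [Finite K] (hfaith : ∀ g, D.χ g = 1 → D.ρ g = 1)
    {S : Multiset G} (hS : IsMinimalProductOne S) (hx : ∃ x ∈ S, D.f x ≠ 0) :
    S.countP (fun g => D.f g = 0) + 2 ≤ q + Nat.card K := by
  by_contra! hlt
  have hq := (Fact.out : q.Prime).two_le
  obtain ⟨x, hxS, hx0⟩ := hx
  obtain ⟨l₀, rfl, hl1⟩ := hS.2.1
  obtain ⟨a, b, rfl⟩ := List.append_of_mem (show x ∈ l₀ by simpa using hxS)
  have hperm : ((x :: b ++ a : List G) : Multiset G) = (a ++ x :: b : List G) := by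
    rw [Multiset.coe_eq_coe]
    exact List.perm_append_comm
  have hl1' : (x :: b ++ a).prod = 1 := List.prod_append_comm_eq_one hl1
  rw [← hperm] at hS hlt
  generalize hl : x :: b ++ a = l at *
  have hhead : ∀ c ∈ l.head?, D.f c ≠ 0 := by
    rw [← hl]; simpa using hx0
  have hxl : x ∈ l := by rw [← hl]; simp
  simp only [Multiset.coe_countP] at hlt
  obtain ⟨l₁, l₂, rfl, hcnt⟩ := List.exists_append_countP_eq (fun g => D.f g = 0) l (q - 1)
    (by omega)
  have hl₁ : l₁ ≠ [] := by
    rintro rfl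
    simp at hcnt
    omega
  have hspread := Spread.of_list_complement hfaith _ l₁ rfl (by
    intro c hc
    apply hhead c
    cases l₁ with
    | nil => simp at hc
    | cons d l => simpa using hc) (by
    intro v hv hv0 hvB hv1
    obtain ⟨p, s, hps⟩ := hv
    rw [← hps] at hl1' hS hxl
    refine hS.infix_false (p := p) (w := v) (s := s ++ l₂) (by simp) (by simpa using hl1') hv1
      hv0 ?_
    intro h0
    simp only [List.append_eq_nil_iff] at h0
    obtain ⟨rfl, rfl, rfl⟩ := h0
    exact hx0 (hvB x (by simpa using hxl)))
  have : Finite D.complement := D.finite_complement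
  obtain ⟨Z, hZle, hZ0, hZ1, -⟩ := Multiset.exists_le_isProductOne D.complement
    ((l₂ : Multiset G).filter (fun g => D.f g = 0)) (by simp) (by
      have h1 := D.card_complement_le
      rw [← Multiset.countP_eq_card_filter, Multiset.coe_countP]
      rw [List.countP_append, hcnt] at hlt
      omega)
  refine hspread.false hS (by omega) ?_ hZ0 hZ1 (by simpa using hl₁)
  rw [← Multiset.coe_add]
  exact add_le_add_right (hZle.trans (Multiset.filter_le _ _)) _

end TwistedMap

theorem Multiset.exists_le_card_eq_of_le {α : Type*} (s : Multiset α) {n : ℕ} (hn : n ≤ card s) :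
    ∃ t ≤ s, card t = n := by
  induction s using Quotient.inductionOn with | _ l
  refine ⟨(l.take n : List α), Multiset.coe_le.mpr (List.take_sublist _ _).subperm, ?_⟩
  simpa using hn

theorem IsMinimalProductOne.one_notMem {G : Type*} [Group G] {S : Multiset G}
    (hS : IsMinimalProductOne S) (hcard : 2 ≤ Multiset.card S) : (1 : G) ∉ S := by
  intro h
  obtain ⟨l, rfl, hl1⟩ := hS.2.1
  obtain ⟨a, b, rfl⟩ := List.append_of_mem (show (1 : G) ∈ l by simpa using h)
  refine hS.infix_false (p := a) (w := [1]) (s := b) (by simp) (by simpa using hl1) (by simp)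
    (by simp) ?_
  intro h0
  simp only [List.append_eq_nil_iff] at h0
  obtain ⟨rfl, rfl⟩ := h0
  simp at hcard

theorem List.nodup_four {α : Type*} {a b c d : α} (h1 : a ≠ b) (h2 : a ≠ c) (h3 : a ≠ d)
    (h4 : b ≠ c) (h5 : b ≠ d) (h6 : c ≠ d) : [a, b, c, d].Nodup := by
  simp [h1, h2, h3, h4, h5, h6]

/-- Four values of the twisted products of a triple, over a field with a cube root of unity. -/
theorem exists_four_values {F : Type*} [Field F] {s u v b c : F} (hs : s ^ 2 + s + 1 = 0)
    (h3 : (3 : F) ≠ 0) (hu : u = s ∨ u = s ^ 2) (hv : v = s ∨ v = s ^ 2) (hb : b ≠ 0)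
    (hc : c ≠ 0) (hbc : b * (1 - v) ≠ c * (1 - u)) :
    ∃ L : List F, L.Nodup ∧ L.length = 4 ∧ ∀ z ∈ L, z = s * b + s * u * c ∨
      z = s * c + s * v * b ∨ z = b + u * s * c ∨ z = b + u * c ∨ z = c + v * s * b ∨
      z = c + v * b := by
  have hs1 : s ≠ 1 := by
    rintro rfl; apply h3; linear_combination hs
  have hs0 : s ≠ 0 := by rintro rfl; simp at hs
  have hs1' : s - 1 ≠ 0 := sub_ne_zero.mpr hs1
  have hs2 : s + 1 ≠ 0 := by
    intro h
    apply hs0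
    have : s ^ 2 = 0 := by linear_combination hs - h
    exact pow_eq_zero_iff (two_ne_zero) |>.mp this
  rcases hu with rfl | rfl <;> rcases hv with rfl | rfl
  · have hbc' : b ≠ c := by rintro rfl; exact hbc rfl
    by_cases h1 : b = -v ^ 2 * c
    · refine ⟨[v * b + v * v * c, b + v * v * c, b + v * c, c + v * v * b], ?_, rfl, by simp⟩
      refine List.nodup_four ?_ ?_ ?_ ?_ ?_ ?_ <;> intro h <;> clear hs2 hs1 hs0 <;> grind
    by_cases h2 : c = -v ^ 2 * b
    · refine ⟨[v * c + v * v * b, c + v * v * b, c + v * b, b + v * v * c], ?_, rfl, by simp⟩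
      refine List.nodup_four ?_ ?_ ?_ ?_ ?_ ?_ <;> intro h <;> clear hs2 hs1 hs0 <;> grind
    · refine ⟨[b + v * v * c, b + v * c, c + v * v * b, c + v * b], ?_, rfl, by simp⟩
      refine List.nodup_four ?_ ?_ ?_ ?_ ?_ ?_ <;> intro h <;> clear hs2 hs1 hs0 <;> grind
  · by_cases h1 : b = c
    · refine ⟨[b + u * u * c, b + u * c, c + u ^ 2 * u * b, u * b + u * u * c], ?_, rfl, by simp⟩
      refine List.nodup_four ?_ ?_ ?_ ?_ ?_ ?_ <;> intro h <;> clear hs2 hs1 hs0 <;> grind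
    · refine ⟨[b + u * u * c, b + u * c, c + u ^ 2 * u * b, c + u ^ 2 * b], ?_, rfl, by simp⟩
      refine List.nodup_four ?_ ?_ ?_ ?_ ?_ ?_ <;> intro h <;> clear hs2 hs1 hs0 <;> grind
  · by_cases h1 : b = c
    · refine ⟨[c + v * v * b, c + v * b, b + v ^ 2 * v * c, v * c + v * v * b], ?_, rfl, by simp⟩
      refine List.nodup_four ?_ ?_ ?_ ?_ ?_ ?_ <;> intro h <;> clear hs2 hs1 hs0 <;> grind
    · refine ⟨[c + v * v * b, c + v * b, b + v ^ 2 * v * c, b + v ^ 2 * c], ?_, rfl, by simp⟩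
      refine List.nodup_four ?_ ?_ ?_ ?_ ?_ ?_ <;> intro h <;> clear hs2 hs1 hs0 <;> grind
  · by_cases h1 : c = -s ^ 2 * b
    · refine ⟨[c + s ^ 2 * s * b, s * b + s * s ^ 2 * c, c + s ^ 2 * b, b + s ^ 2 * c], ?_, rfl, by simp⟩
      refine List.nodup_four ?_ ?_ ?_ ?_ ?_ ?_ <;> intro h <;> clear hs2 hs1 hs0 <;> grind
    · refine ⟨[c + s ^ 2 * s * b, s * b + s * s ^ 2 * c, c + s ^ 2 * b, s * c + s * s ^ 2 * b], ?_, rfl, by simp⟩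
      refine List.nodup_four ?_ ?_ ?_ ?_ ?_ ?_ <;> intro h <;> clear hs2 hs1 hs0 <;> grind


namespace TwistedMap

variable {G K : Type*} [Group G] [CommGroup K] {q : ℕ} {D : TwistedMap G K q} [Fact q.Prime]

theorem card_ker_chi_le [Finite G] (hfaith : ∀ g, D.χ g = 1 → D.ρ g = 1) :
    Nat.card D.χ.ker ≤ q := by
  have h : Function.Injective (fun g : D.χ.ker => D.f g) := by
    rintro ⟨g, hg⟩ ⟨h, hh⟩ he
    rw [MonoidHom.mem_ker] at hg hh
    have he' : D.f g = D.f h := he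
    have h1 : D.f (g * h⁻¹) = 0 := by
      rw [D.f_mul, D.f_inv, hg, hh, he']; simp
    have h2 : D.χ (g * h⁻¹) = 1 := by rw [map_mul, map_inv, hg, hh]; simp
    exact Subtype.ext (mul_inv_eq_one.mp (D.eq_one _ h1 (hfaith _ h2)))
  simpa using Nat.card_le_card_of_injective _ h

theorem Spread.false_of_card [Finite K] (hfaith : ∀ g, D.χ g = 1 → D.ρ g = 1)
    {S : Multiset G} (hS : IsMinimalProductOne S) {T : Multiset G} {n : ℕ}
    (hT : D.Spread T n) (hn : q ≤ n + 1) (hle : T ≤ S) (hT0 : T ≠ 0)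
    (hc : q + Nat.card K + Multiset.card T ≤ Multiset.card S + 1) : False := by
  obtain ⟨W, rfl⟩ := Multiset.le_iff_exists_add.mp hle
  rw [Multiset.card_add] at hc
  obtain ⟨Z, hZ, hZ0, hZ1⟩ := exists_le_isProductOne_of_card hfaith W (by omega)
  exact hT.false hS hn (add_le_add_right hZ T) hZ0 hZ1 hT0

theorem exists_chi_ne_one [Finite G] (hfaith : ∀ g, D.χ g = 1 → D.ρ g = 1)
    {S : Multiset G} (hS : IsMinimalProductOne S) (hc : q < Multiset.card S) :
    ∃ x ∈ S, D.χ x ≠ 1 := by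
  by_contra! hcon
  have := hS.card_le_of_subgroup D.χ.ker hcon
  have := card_ker_chi_le hfaith
  omega

theorem countP_fixedPoint_none_lt [Finite G] [Finite K] (hfaith : ∀ g, D.χ g = 1 → D.ρ g = 1)
    {S : Multiset G} (hS : IsMinimalProductOne S)
    (hV : ∀ x ∈ S, D.χ x = 1 → D.f x ≠ 0)
    (hc : 2 * q + Nat.card K ≤ Multiset.card S + 1) :
    S.countP (fun x => D.fixedPoint x = none) + 1 < q := by
  by_contra! hge
  have hK : 0 < Nat.card K := Nat.card_pos
  have hq := (Fact.out : q.Prime).two_le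
  obtain ⟨x, hxS, hx⟩ := exists_chi_ne_one hfaith hS (by omega)
  rw [Multiset.countP_eq_card_filter] at hge
  obtain ⟨A, hA, hAc⟩ := Multiset.exists_le_card_eq_of_le
    (S.filter (fun x => D.fixedPoint x = none)) (n := q - 1) (by omega)
  have hA' : ∀ a ∈ A, D.χ a = 1 ∧ D.f a ≠ 0 := by
    intro a ha
    have := Multiset.mem_of_le hA ha
    rw [Multiset.mem_filter, fixedPoint_eq_none_iff] at this
    exact ⟨this.2, hV a this.1 this.2⟩
  have hle : A + {x} ≤ S := by
    classical
    rw [← Multiset.filter_add_not (fun x => D.fixedPoint x = none) S]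
    refine add_le_add hA ?_
    rw [Multiset.singleton_le, Multiset.mem_filter, fixedPoint_eq_none_iff]
    exact ⟨hxS, hx⟩
  have hs := Spread.of_translations hx A hA'
  refine hs.false_of_card hfaith hS (by omega) hle ?_ ?_
  · intro h
    have := congrArg Multiset.card h
    simp at this
  · simp [hAc]
    omega

theorem countP_fixedPoint_some_le [Finite K] (hfaith : ∀ g, D.χ g = 1 → D.ρ g = 1)
    {S : Multiset G} (hS : IsMinimalProductOne S) (hc : Nat.card K < Multiset.card S)
    (p : ZMod q) : S.countP (fun x => D.fixedPoint x = some p) + 2 ≤ q + Nat.card K := by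
  have : Finite (D.shift p).complement := (D.shift p).finite_complement
  have h1 := countP_complement_le (D := D.shift p) hfaith hS (by
    by_contra! hcon
    have h2 := hS.card_le_of_subgroup (D.shift p).complement hcon
    have h3 := (D.shift p).card_complement_le
    omega)
  refine le_trans ?_ h1
  gcongr
  simp only [Multiset.countP_eq_card_filter]
  apply Multiset.card_le_card
  apply Multiset.monotone_filter_right
  intro x hx
  exact (fixedPoint_eq_some_iff.mp hx).2

theorem card_eq_countP_add {S : Multiset G} (b : Option (ZMod q)) :
    Multiset.card S = S.countP (fun x => D.fixedPoint x = b) +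
      S.countP (fun x => D.fixedPoint x ≠ b) :=
  Multiset.card_eq_countP_add_countP _ _

theorem four_mul_card_le_of_four_le [Finite G] [Finite K]
    (hfaith : ∀ g, D.χ g = 1 → D.ρ g = 1) (hm : 4 ≤ Nat.card K) (hmq : Nat.card K < q)
    {S : Multiset G} (hS : IsMinimalProductOne S) :
    4 * Multiset.card S ≤ 3 * (q * Nat.card K) := by
  by_contra! hlt
  set m := Nat.card K
  have hl : 3 * q + m ≤ Multiset.card S + 3 := by
    by_contra! h
    nlinarith
  have hV : ∀ x ∈ S, D.χ x = 1 → D.f x ≠ 0 := by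
    intro x hx h1 h0
    exact hS.one_notMem (by omega) (D.eq_one x h0 (hfaith x h1) ▸ hx)
  have hL := countP_fixedPoint_none_lt hfaith hS hV (by omega)
  obtain ⟨T, hT, hTc, hTs⟩ := exists_spread_of_matching (D := D) (q - 1) S hV (by omega) (by
    intro b
    have h1 := card_eq_countP_add (D := D) (S := S) b
    cases b with
    | none => omega
    | some p =>
      have h2 := countP_fixedPoint_some_le hfaith hS (by omega) p
      omega)
  refine hTs.false_of_card hfaith hS (by omega) hT ?_ (by omega)
  rintro rfl
  simp at hTc
  omega

theorem f_mul_mul (x y w : G) :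
    D.f (x * (y * w)) = D.f x + D.χ x * D.f y + D.χ x * D.χ y * D.f w := by
  rw [D.f_mul, D.f_mul]; ring

theorem values_triple (x y w : G) {v : ZMod q}
    (h : v = D.f (x * (y * w)) ∨ v = D.f (x * (w * y)) ∨ v = D.f (y * (x * w)) ∨
      v = D.f (y * (w * x)) ∨ v = D.f (w * (x * y)) ∨ v = D.f (w * (y * x))) :
    v ∈ D.values {x, y, w} := by
  have key : ∀ a b c : G, ({a, b, c} : Multiset G) = {x, y, w} →
      D.f (a * (b * c)) ∈ D.values {x, y, w} := by
    intro a b c h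
    refine mem_values.mpr ⟨[a, b, c], h, by simp⟩
  have e1 : ({x, w, y} : Multiset G) = {x, y, w} := by
    simp only [Multiset.insert_eq_cons, ← Multiset.singleton_add]; abel
  have e2 : ({y, x, w} : Multiset G) = {x, y, w} := by
    simp only [Multiset.insert_eq_cons, ← Multiset.singleton_add]; abel
  have e3 : ({y, w, x} : Multiset G) = {x, y, w} := by
    simp only [Multiset.insert_eq_cons, ← Multiset.singleton_add]; abel
  have e4 : ({w, x, y} : Multiset G) = {x, y, w} := by
    simp only [Multiset.insert_eq_cons, ← Multiset.singleton_add]; abel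
  have e5 : ({w, y, x} : Multiset G) = {x, y, w} := by
    simp only [Multiset.insert_eq_cons, ← Multiset.singleton_add]; abel
  rcases h with rfl | rfl | rfl | rfl | rfl | rfl
  exacts [key _ _ _ rfl, key _ _ _ e1, key _ _ _ e2, key _ _ _ e3, key _ _ _ e4, key _ _ _ e5]

theorem Spread.of_shift {T : Multiset G} {n : ℕ} (p : ZMod q) (h : (D.shift p).Spread T n) :
    D.Spread T n := by
  refine le_trans h (Finset.card_le_card_of_injOn
    (fun v => v + (1 - ((T.map D.χ).prod : (ZMod q)ˣ)) * p) ?_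
    (fun a _ b _ h => add_right_cancel h))
  intro a ha
  obtain ⟨l, hl, rfl⟩ := mem_values.mp ha
  refine mem_values.mpr ⟨l, hl, ?_⟩
  rw [← D.chi_prod hl]
  simp [shift]

theorem exists_shift_f_eq_zero {x : G} (hx : D.χ x ≠ 1) : ∃ p, (D.shift p).f x = 0 := by
  have := one_sub_chi_ne_zero hx
  exact ⟨D.f x / (1 - D.χ x), by simp [shift, mul_div_cancel₀ _ this]⟩

theorem chi_sq_add (hK : Nat.card K = 3) {g : G} (hg : D.χ g ≠ 1) :
    (D.χ g : ZMod q) ^ 2 + D.χ g + 1 = 0 := by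
  have h1 : (D.χ g : ZMod q) ^ 3 = 1 := by
    simpa using congrArg Units.val (chi_pow_three (D := D) hK g)
  have h2 := one_sub_chi_ne_zero hg
  apply mul_left_cancel₀ h2
  linear_combination -h1

theorem Spread.triple (hK : Nat.card K = 3) (hq : (3 : ZMod q) ≠ 0) {x y w : G}
    (hx : D.χ x ≠ 1) (hy : D.χ y ≠ 1) (hw : D.χ w ≠ 1) (hxy : D.f (x * y) ≠ D.f (y * x))
    (hxw : D.f (x * w) ≠ D.f (w * x)) (hyw : D.f (y * w) ≠ D.f (w * y)) :
    D.Spread {x, y, w} 3 := by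
  obtain ⟨p, hp⟩ := exists_shift_f_eq_zero hx
  apply Spread.of_shift p
  rw [← shift_f_mul_ne_iff p] at hxy hxw hyw
  have hx' : (D.shift p).χ x ≠ 1 := hx
  have hy' : (D.shift p).χ y ≠ 1 := hy
  have hw' : (D.shift p).χ w ≠ 1 := hw
  clear hx hy hw
  generalize D.shift p = D' at *
  rw [Ne, f_mul_comm_iff, hp] at hxy hxw
  rw [Ne, f_mul_comm_iff] at hyw
  have hs := chi_sq_add hK hx'
  have root : ∀ g, D'.χ g ≠ 1 → (D'.χ g : ZMod q) = D'.χ x ∨ (D'.χ g : ZMod q) = D'.χ x ^ 2 := by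
    intro g hg
    have h1 := chi_sq_add hK hg
    have : ((D'.χ g : ZMod q) - D'.χ x) * (D'.χ g - D'.χ x ^ 2) = 0 := by
      linear_combination h1 + (-D'.χ g + D'.χ x - 1) * hs
    rcases mul_eq_zero.mp this with h | h
    · exact Or.inl (sub_eq_zero.mp h)
    · exact Or.inr (sub_eq_zero.mp h)
  obtain ⟨L, hL, hlen, hmem⟩ := exists_four_values hs hq (root y hy') (root w hw')
    (b := D'.f y) (c := D'.f w) (by intro h; simp [h] at hxy) (by intro h; simp [h] at hxw) hyw
  refine Spread.of_list L hL (fun v hv => values_triple x y w ?_) (by omega)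
  simp only [f_mul_mul, hp]
  have := hmem v hv
  ring_nf at this ⊢
  exact this

theorem exists_spread_triples (hK : Nat.card K = 3) (hq : (3 : ZMod q) ≠ 0) (t : ℕ) :
    ∀ V : Multiset G, 3 * t + 4 ≤ Multiset.card V → (∀ x ∈ V, D.χ x ≠ 1) →
      (∀ b, V.countP (fun x => D.fixedPoint x = b) ≤ 3) →
      ∃ T ≤ V, Multiset.card T = 3 * t ∧ D.Spread T (3 * t) := by
  classical
  induction t with
  | zero => intro V _ _ _; exact ⟨0, by simp, by simp, Spread.zero _⟩
  | succ t ih =>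
    intro V hV hχ hb
    obtain ⟨x, hx⟩ := Multiset.card_pos_iff_exists_mem.mp (show 0 < Multiset.card V by omega)
    have h1 := card_eq_countP_add (D := D) (S := V) (D.fixedPoint x)
    have h2 := hb (D.fixedPoint x)
    obtain ⟨y, hy, hyx⟩ := Multiset.countP_pos.mp
      (show 0 < V.countP (fun y => D.fixedPoint y ≠ D.fixedPoint x) by omega)
    have h3 := card_eq_countP_add (D := D)
      (S := V.filter (fun y => D.fixedPoint y ≠ D.fixedPoint x)) (D.fixedPoint y)
    have h4 : (V.filter (fun z => D.fixedPoint z ≠ D.fixedPoint x)).countP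
        (fun z => D.fixedPoint z = D.fixedPoint y) ≤ 3 :=
      le_trans (Multiset.countP_le_of_le _ (Multiset.filter_le _ _)) (hb _)
    rw [← Multiset.countP_eq_card_filter] at h3
    obtain ⟨w, hw, hwy⟩ := Multiset.countP_pos.mp
      (show 0 < (V.filter (fun z => D.fixedPoint z ≠ D.fixedPoint x)).countP
        (fun z => D.fixedPoint z ≠ D.fixedPoint y) by omega)
    obtain ⟨hw, hwx⟩ := Multiset.mem_filter.mp hw
    have hle : ({x, y, w} : Multiset G) ≤ V := by
      rw [Multiset.le_iff_subset]
      · intro z hz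
        simp only [Multiset.insert_eq_cons, Multiset.mem_cons, Multiset.mem_singleton] at hz
        rcases hz with rfl | rfl | rfl <;> assumption
      · have a1 : x ≠ y := by rintro rfl; exact hyx rfl
        have a2 : x ≠ w := by rintro rfl; exact hwx rfl
        have a3 : y ≠ w := by rintro rfl; exact hwy rfl
        simp [a1, a2, a3]
    obtain ⟨V', rfl⟩ := Multiset.le_iff_exists_add.mp hle
    obtain ⟨T, hT, hTc, hTs⟩ := ih V' (by simp at hV; omega)
      (fun z hz => hχ z (Multiset.mem_add.mpr (Or.inr hz)))
      (fun b => le_trans (Multiset.countP_le_of_le _ (Multiset.le_add_left _ _)) (hb b))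
    have key : ∀ z z', z ∈ ({x, y, w} : Multiset G) + V' → z' ∈ ({x, y, w} : Multiset G) + V' →
        D.fixedPoint z ≠ D.fixedPoint z' → D.f (z * z') ≠ D.f (z' * z) := fun z z' hz hz' h =>
      f_mul_ne_of_fixedPoint_ne (fun h => absurd h (hχ z hz)) (fun h => absurd h (hχ z' hz')) h
    refine ⟨{x, y, w} + T, add_le_add_right hT _, by simp [hTc]; ring, ?_⟩
    have := (Spread.triple hK hq (hχ x hx) (hχ y hy) (hχ w hw) (key x y hx hy (Ne.symm hyx))
      (key x w hx hw (Ne.symm hwx)) (key y w hy hw (Ne.symm hwy))).add hTs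
    exact this.mono (by omega)

theorem Spread.of_same_character (hK : Nat.card K = 3) {x w w' : G} (hx : D.χ x ≠ 1)
    (hw : D.χ w ≠ 1) (hχ : D.χ w' = D.χ w) (hww : D.fixedPoint w' = D.fixedPoint w)
    (hxw : D.fixedPoint x ≠ D.fixedPoint w) : D.Spread {x, w, w'} 2 := by
  have hxw' := f_mul_ne_of_fixedPoint_ne (fun h => absurd h hx) (fun h => absurd h hw) hxw
  obtain ⟨p, hp⟩ := exists_shift_f_eq_zero hw
  have hp' : (D.shift p).f w' = 0 := by
    have := fixedPoint_eq_some_iff.mpr ⟨hw, hp⟩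
    rw [← hww] at this
    exact (fixedPoint_eq_some_iff.mp this).2
  apply Spread.of_shift p
  rw [← shift_f_mul_ne_iff p] at hxw'
  have hw1 : (D.shift p).χ w ≠ 1 := hw
  have hχ' : (D.shift p).χ w' = (D.shift p).χ w := hχ
  clear hx hw hxw hww hχ
  generalize D.shift p = D' at *
  rw [Ne, f_mul_comm_iff, hp] at hxw'
  have hx0 : D'.f x ≠ 0 := by intro h; simp [h] at hxw'
  have h1 := one_sub_chi_ne_zero hw1
  have h2 := chi_sq_add hK hw1
  have h3 : (D'.χ w : ZMod q) ≠ 0 := Units.ne_zero _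
  have h4 : 1 + (D'.χ w : ZMod q) ≠ 0 := by
    intro h
    apply h3
    have : (D'.χ w : ZMod q) ^ 2 = 0 := by linear_combination h2 - h
    exact pow_eq_zero_iff two_ne_zero |>.mp this
  refine Spread.of_list [D'.f x, D'.χ w * D'.f x, D'.χ w ^ 2 * D'.f x] ?_ ?_ (by simp)
  · simp only [List.nodup_cons, List.mem_cons, List.not_mem_nil, or_false, not_or,
      not_false_eq_true, List.nodup_nil, and_true]
    refine ⟨⟨fun h => ?_, fun h => ?_⟩, fun h => ?_⟩
    · exact mul_ne_zero h1 hx0 (by linear_combination h)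
    · exact mul_ne_zero (mul_ne_zero h1 h4) hx0 (by linear_combination h)
    · exact mul_ne_zero (mul_ne_zero h1 h3) hx0 (by linear_combination h)
  · intro v hv
    simp only [List.mem_cons, List.not_mem_nil, or_false] at hv
    apply values_triple
    simp only [f_mul_mul, hp, hp', hχ']
    rcases hv with rfl | rfl | rfl
    · left; ring
    · right; right; left; ring
    · right; right; right; left; ring

theorem three_dvd_sub_one (hK : Nat.card K = 3) {x : G} (hx : D.χ x ≠ 1) : 3 ∣ q - 1 := by
  have : Fact (Nat.Prime 3) := ⟨Nat.prime_three⟩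
  rw [← ZMod.card_units q, ← orderOf_eq_prime (chi_pow_three hK x) hx]
  exact orderOf_dvd_card

/-- Reserving a short product-one part inside a class, then matching the remaining terms. -/
theorem false_or_of_countP_ge_three [Finite G] [Finite K]
    (hfaith : ∀ g, D.χ g = 1 → D.ρ g = 1) (hK : Nat.card K = 3) (hq : 7 ≤ q) {S : Multiset G}
    (hS : IsMinimalProductOne S) (hl : 9 * q < 4 * Multiset.card S)
    (hV : ∀ x ∈ S, D.χ x = 1 → D.f x ≠ 0) {p : ZMod q}
    (hp : 3 ≤ S.countP (fun x => D.fixedPoint x = some p)) :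
    q = 7 ∧ Multiset.card S = 16 ∧
      ∃ p' ≠ p, S.countP (fun x => D.fixedPoint x = some p') = 8 := by
  classical
  by_contra hcon
  have hmax : ∀ p' ≠ p, S.countP (fun x => D.fixedPoint x = some p') + q + 2 ≤
      Multiset.card S := by
    intro p' hp'
    have h1 := countP_fixedPoint_some_le (D := D) hfaith hS (by omega) p'
    by_contra! h
    have hq7 : q = 7 ∨ q = 8 ∨ q = 9 ∨ q = 10 ∨ 11 ≤ q := by omega
    rcases hq7 with rfl | rfl | rfl | rfl | h7
    · exact hcon ⟨rfl, by omega, p', hp', by omega⟩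
    · exact absurd (Fact.out : Nat.Prime 8) (by norm_num)
    · exact absurd (Fact.out : Nat.Prime 9) (by norm_num)
    · exact absurd (Fact.out : Nat.Prime 10) (by norm_num)
    · omega
  rw [Multiset.countP_eq_card_filter] at hp
  obtain ⟨R, hR, hRc⟩ := Multiset.exists_le_card_eq_of_le _ hp
  have hRmem : ∀ x ∈ R, D.fixedPoint x = some p := fun x hx =>
    (Multiset.mem_filter.mp (Multiset.mem_of_le hR hx)).2
  have : Finite (D.shift p).complement := (D.shift p).finite_complement
  obtain ⟨Z, hZ, hZ0, hZ1, -⟩ := Multiset.exists_le_isProductOne (D.shift p).complement R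
    (fun x hx => (fixedPoint_eq_some_iff.mp (hRmem x hx)).2)
    (by have := (D.shift p).card_complement_le; omega)
  obtain ⟨V, hVS⟩ := Multiset.le_iff_exists_add.mp (hR.trans (Multiset.filter_le _ S))
  have hL := countP_fixedPoint_none_lt hfaith hS hV (by omega)
  have hcard : Multiset.card S = 3 + Multiset.card V := by rw [hVS, Multiset.card_add, hRc]
  have hcount : ∀ b, V.countP (fun x => D.fixedPoint x = b) ≤
      S.countP (fun x => D.fixedPoint x = b) := by
    intro b; rw [hVS, Multiset.countP_add]; omega
  obtain ⟨T, hT, hTc, hTs⟩ := exists_spread_of_matching (D := D) (q - 1) V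
    (fun x hx => hV x (by rw [hVS]; exact Multiset.mem_add.mpr (Or.inr hx))) (by omega) (by
    intro b
    have h1 := card_eq_countP_add (D := D) (S := V) b
    have h2 := hcount b
    cases b with
    | none => omega
    | some p' =>
      by_cases hpp : p' = p
      · subst hpp
        have h3 := countP_fixedPoint_some_le (D := D) hfaith hS (by omega) p'
        have h4 : S.countP (fun x => D.fixedPoint x = some p') =
            3 + V.countP (fun x => D.fixedPoint x = some p') := by
          rw [hVS, Multiset.countP_add, (Multiset.countP_eq_card).mpr hRmem, hRc]
        omega
      · have := hmax p' hpp
        omega)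
  refine hTs.false hS (by omega) (Z := Z) ?_ hZ0 hZ1 ?_
  · rw [hVS, add_comm]
    exact add_le_add hZ hT
  · rintro rfl
    simp at hTc
    omega

theorem false_of_two_classes [Finite K] (hK : Nat.card K = 3) (hq : q = 7) {S : Multiset G}
    (hS : IsMinimalProductOne S) (hc : Multiset.card S = 16)
    (hV : ∀ x ∈ S, D.χ x = 1 → D.f x ≠ 0) {p p' : ZMod q} (hp : p' ≠ p)
    (h1 : S.countP (fun x => D.fixedPoint x = some p) = 8)
    (h2 : S.countP (fun x => D.fixedPoint x = some p') = 8) : False := by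
  classical
  have hsplit := Multiset.filter_add_not (fun x => D.fixedPoint x = some p) S
  have hB' : S.filter (fun x => D.fixedPoint x = some p') =
      S.filter (fun x => ¬ D.fixedPoint x = some p) := by
    apply Multiset.eq_of_le_of_card_le
    · apply Multiset.monotone_filter_right
      intro x hx h
      rw [hx] at h
      exact hp (Option.some.inj h)
    · have h3 := congrArg Multiset.card hsplit
      rw [Multiset.card_add, ← Multiset.countP_eq_card_filter, h1] at h3
      rw [← Multiset.countP_eq_card_filter (p := fun x => D.fixedPoint x = some p'), h2]
      omega
  rw [← hB'] at hsplit
  rw [Multiset.countP_eq_card_filter] at h1 h2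
  generalize hA1 : S.filter (fun x => D.fixedPoint x = some p) = A1 at *
  generalize hA2 : S.filter (fun x => D.fixedPoint x = some p') = A2 at *
  have hm1 : ∀ x ∈ A1, D.fixedPoint x = some p := fun x hx =>
    by
    rw [← hA1] at hx; exact (Multiset.mem_filter.mp hx).2
  have hm2 : ∀ x ∈ A2, D.fixedPoint x = some p' := fun x hx =>
    by
    rw [← hA2] at hx; exact (Multiset.mem_filter.mp hx).2
  clear hA1 hA2 hB'
  obtain ⟨R, hR, hRc⟩ := Multiset.exists_le_card_eq_of_le A1 (n := 3) (by omega)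
  obtain ⟨C1, rfl⟩ := Multiset.le_iff_exists_add.mp hR
  have : Finite (D.shift p).complement := (D.shift p).finite_complement
  obtain ⟨Z, hZ, hZ0, hZ1, -⟩ := Multiset.exists_le_isProductOne (D.shift p).complement R
    (fun x hx => (fixedPoint_eq_some_iff.mp (hm1 x (Multiset.mem_of_le hR hx))).2)
    (by have := (D.shift p).card_complement_le; omega)
  rw [Multiset.card_add, hRc] at h1
  obtain ⟨x, hx⟩ := Multiset.card_pos_iff_exists_mem.mp (show 0 < Multiset.card C1 by omega)
  obtain ⟨C1, rfl⟩ := Multiset.exists_cons_of_mem hx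
  rw [Multiset.card_cons] at h1
  have hsame : ∃ w w' B, A2 = w ::ₘ w' ::ₘ B ∧ D.χ w' = D.χ w := by
    obtain ⟨E, hE, hEc⟩ := Multiset.exists_le_card_eq_of_le A2 (n := 3) (by omega)
    obtain ⟨B, rfl⟩ := Multiset.le_iff_exists_add.mp hE
    obtain ⟨a, b, c, rfl⟩ := Multiset.card_eq_three.mp hEc
    have hne : ∀ g ∈ ({a, b, c} : Multiset G) + B, D.χ g ≠ 1 := fun g hg =>
      (fixedPoint_eq_some_iff.mp (hm2 g hg)).1
    have ha := hne a (by simp)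
    have hb := hne b (by simp)
    have hc' := hne c (by simp)
    by_cases h1 : D.χ b = D.χ a
    · exact ⟨a, b, c ::ₘ B, by simp, h1⟩
    by_cases h2 : D.χ c = D.χ a
    · exact ⟨a, c, b ::ₘ B, by
        simp only [Multiset.insert_eq_cons, ← Multiset.singleton_add]; abel, h2⟩
    refine ⟨b, c, a ::ₘ B, by
      simp only [Multiset.insert_eq_cons, ← Multiset.singleton_add]; abel, ?_⟩
    have sa := chi_sq_add hK ha
    have key : ∀ g, D.χ g ≠ 1 → D.χ g ≠ D.χ a → (D.χ g : ZMod q) = D.χ a ^ 2 := by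
      intro g hg hga
      have h1 := chi_sq_add hK hg
      have : ((D.χ g : ZMod q) - D.χ a) * (D.χ g - D.χ a ^ 2) = 0 := by
        linear_combination h1 + (-D.χ g + D.χ a - 1) * sa
      rcases mul_eq_zero.mp this with h | h
      · exact absurd (Units.ext (sub_eq_zero.mp h)) hga
      · exact sub_eq_zero.mp h
    exact Units.ext ((key c hc' h2).trans (key b hb h1).symm)
  obtain ⟨w, w', B, rfl, hχ⟩ := hsame
  simp only [Multiset.card_cons] at h2
  have hfx := hm1 x (by simp)
  have hfw := hm2 w (by simp)
  have hblock := Spread.of_same_character hK (fixedPoint_eq_some_iff.mp hfx).1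
    (fixedPoint_eq_some_iff.mp hfw).1 hχ ((hm2 w' (by simp)).trans hfw.symm)
    (by rw [hfx, hfw]; simpa using Ne.symm hp)
  obtain ⟨T, hT, hTc, hTs⟩ := exists_spread_of_matching (D := D) 4 (C1 + B)
    (fun y hy => hV y (by
      rw [← hsplit]
      rcases Multiset.mem_add.mp hy with h | h <;> simp [h])) (by rw [Multiset.card_add]; omega) (by
    intro b
    rw [Multiset.countP_add]
    by_cases hb : b = some p
    · have : B.countP (fun x => D.fixedPoint x ≠ b) = Multiset.card B := by
        rw [Multiset.countP_eq_card]
        intro y hy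
        rw [hm2 y (by simp [hy]), hb]
        simpa using hp
      omega
    · have : C1.countP (fun x => D.fixedPoint x ≠ b) = Multiset.card C1 := by
        rw [Multiset.countP_eq_card]
        intro y hy
        rw [hm1 y (by simp [hy])]
        exact Ne.symm hb
      omega)
  refine (hblock.add hTs).false hS (by omega) (Z := Z) ?_ hZ0 hZ1 (by simp)
  calc {x, w, w'} + T + Z ≤ {x, w, w'} + (C1 + B) + R :=
        add_le_add (add_le_add_right hT _) hZ
    _ = S := by
      rw [← hsplit]
      simp only [Multiset.insert_eq_cons, ← Multiset.singleton_add]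
      abel

theorem four_mul_card_le_of_eq_three [Finite G] [Finite K]
    (hfaith : ∀ g, D.χ g = 1 → D.ρ g = 1) (hK : Nat.card K = 3) (hmq : 3 < q)
    {S : Multiset G} (hS : IsMinimalProductOne S) :
    4 * Multiset.card S ≤ 3 * (q * Nat.card K) := by
  classical
  by_contra! hlt
  have hl : 9 * q < 4 * Multiset.card S := by rw [hK] at hlt; omega
  obtain ⟨x, hxS, hx⟩ := exists_chi_ne_one (D := D) hfaith hS (by omega)
  have h3 := three_dvd_sub_one hK hx
  have hq7 : 7 ≤ q := by
    have : q ≠ 4 := by rintro rfl; exact absurd (Fact.out : Nat.Prime 4) (by norm_num)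
    omega
  have h30 : (3 : ZMod q) ≠ 0 := by
    intro h
    have : ((3 : ℕ) : ZMod q) = 0 := by exact_mod_cast h
    rw [ZMod.natCast_eq_zero_iff] at this
    have := Nat.le_of_dvd (by norm_num) this
    omega
  have hV : ∀ x ∈ S, D.χ x = 1 → D.f x ≠ 0 := by
    intro x hx h1 h0
    exact hS.one_notMem (by omega) (D.eq_one x h0 (hfaith x h1) ▸ hx)
  by_cases hp : ∃ p, 3 < S.countP (fun x => D.fixedPoint x = some p)
  · obtain ⟨p, hp⟩ := hp
    obtain ⟨h7, h16, p', -, hp8⟩ :=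
      false_or_of_countP_ge_three hfaith hK hq7 hS hl hV (p := p) (by omega)
    obtain ⟨-, -, p'', hne, hp8'⟩ :=
      false_or_of_countP_ge_three hfaith hK hq7 hS hl hV (p := p') (by omega)
    exact false_of_two_classes hK h7 hS h16 hV hne hp8 hp8'
  · push Not at hp
    have hL := countP_fixedPoint_none_lt hfaith hS hV (by omega)
    have h1 := card_eq_countP_add (D := D) (S := S) none
    obtain ⟨T, hT, hTc, hTs⟩ := exists_spread_triples (D := D) hK h30 ((q - 1) / 3)
      (S.filter (fun x => D.fixedPoint x ≠ none)) (by
        rw [← Multiset.countP_eq_card_filter]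
        omega) (fun y hy => by
        have := (Multiset.mem_filter.mp hy).2
        rwa [Ne, fixedPoint_eq_none_iff] at this) (by
        intro b
        cases b with
        | none =>
          rw [Multiset.countP_filter]
          have : S.countP (fun x => D.fixedPoint x = none ∧ D.fixedPoint x ≠ none) = 0 := by
            rw [Multiset.countP_eq_zero]
            tauto
          omega
        | some p => exact le_trans (Multiset.countP_le_of_le _ (Multiset.filter_le _ _)) (hp p))
    refine hTs.false_of_card hfaith hS (by omega) (hT.trans (Multiset.filter_le _ _)) ?_ (by omega)
    rintro rfl
    simp at hTc
    omega

/-- Atoms of a nonabelian group `C_q ⋊ C_m` with faithful action and `m ≥ 3` are short. -/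
theorem four_mul_card_le [Finite G] [Finite K] (hfaith : ∀ g, D.χ g = 1 → D.ρ g = 1)
    (hm : 3 ≤ Nat.card K) (hmq : Nat.card K < q) {S : Multiset G} (hS : IsMinimalProductOne S) :
    4 * Multiset.card S ≤ 3 * (q * Nat.card K) := by
  rcases hm.eq_or_lt with h | h
  · exact four_mul_card_le_of_eq_three hfaith h.symm (by omega) hS
  · exact four_mul_card_le_of_four_le hfaith h hmq hS

end TwistedMap

theorem IsProductOne.map_prod_eq_one {G A : Type*} [Group G] [CommGroup A] (π : G →* A)
    {T : Multiset G} (h : IsProductOne T) : (T.map π).prod = 1 := by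
  obtain ⟨l, rfl, h1⟩ := h
  rw [Multiset.map_coe, Multiset.prod_coe, ← map_list_prod, h1, map_one]

theorem Multiset.prod_map_sum_ofList {G A : Type*} [Group G] [CommGroup A] (π : G →* A)
    (M : Multiset (List G)) :
    ((M.map Multiset.ofList).sum.map π).prod = ((M.map List.prod).map π).prod := by
  induction M using Multiset.induction_on with
  | empty => simp
  | cons b M ih => simp [ih, map_list_prod]

/-- A product-one sequence of images lifts to blocks whose images are atoms. -/
theorem Multiset.exists_blocks_map {G Q : Type*} [Group G] [Group Q] (φ : G →* Q) (n : ℕ) :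
    ∀ T : Multiset G, card T = n → IsProductOne (T.map φ) →
      ∃ M : Multiset (List G), T = (M.map Multiset.ofList).sum ∧
        ∀ b ∈ M, φ b.prod = 1 ∧ IsMinimalProductOne ((b : Multiset G).map φ) := by
  induction n using Nat.strong_induction_on with | _ n ih
  intro T hT h1
  by_cases h0 : T = 0
  · exact ⟨0, by simp [h0], by simp⟩
  by_cases hmin : IsMinimalProductOne (T.map φ)
  · obtain ⟨l, hl, hl1⟩ := h1
    obtain ⟨l', rfl, hl'⟩ := Multiset.exists_map_eq_coe φ T l hl.symm
    refine ⟨{l'}, by simp, ?_⟩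
    intro b hb
    rw [Multiset.mem_singleton] at hb
    subst hb
    exact ⟨by rw [map_list_prod, hl', hl1], hmin⟩
  · have : ∃ T₁ T₂ : Multiset Q, T₁ ≠ 0 ∧ T₂ ≠ 0 ∧ T.map φ = T₁ + T₂ ∧
        IsProductOne T₁ ∧ IsProductOne T₂ := by
      by_contra hcon
      exact hmin ⟨by simpa using h0, h1, hcon⟩
    obtain ⟨T₁, T₂, h1, h2, h12, hp1, hp2⟩ := this
    obtain ⟨U₁, U₂, rfl, rfl, rfl⟩ := Multiset.exists_map_eq_add _ _ _ _ h12
    rw [Ne, Multiset.map_eq_zero, ← Multiset.card_eq_zero] at h1 h2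
    rw [Multiset.card_add] at hT
    obtain ⟨M₁, e1, hM₁⟩ := ih (card U₁) (by omega) U₁ rfl hp1
    obtain ⟨M₂, e2, hM₂⟩ := ih (card U₂) (by omega) U₂ rfl hp2
    refine ⟨M₁ + M₂, by rw [Multiset.map_add, Multiset.sum_add, ← e1, ← e2], ?_⟩
    intro b hb
    rcases Multiset.mem_add.mp hb with h | h
    exacts [hM₁ b h, hM₂ b h]

/-- Length bounds for atoms lift along a quotient by a subgroup meeting the commutator trivially. -/
theorem IsMinimalProductOne.four_mul_card_le_of_hom {G Q : Type*} [Group G] [Group Q] [Finite G]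
    (φ : G →* Q) (hφ : φ.ker ⊓ commutator G = ⊥) {B : ℕ}
    (hB : ∀ S : Multiset Q, IsMinimalProductOne S → 4 * Multiset.card S ≤ 3 * B) {S : Multiset G}
    (hS : IsMinimalProductOne S) : 4 * Multiset.card S ≤ 3 * (B * Nat.card φ.ker) := by
  obtain ⟨M, hM, hblock⟩ := Multiset.exists_blocks_map φ _ S rfl (by
    obtain ⟨l, rfl, h1⟩ := hS.2.1
    exact ⟨l.map φ, by simp, by rw [← map_list_prod, h1, map_one]⟩)
  have hMc : Multiset.card M ≤ Nat.card φ.ker := by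
    by_contra! hlt
    have hker : ∀ g ∈ M.map List.prod, g ∈ φ.ker := by
      intro g hg
      obtain ⟨b, hb, rfl⟩ := Multiset.mem_map.mp hg
      exact (hblock b hb).1
    obtain ⟨Z, hZ, hZ0, hZ1, hZc⟩ := Multiset.exists_le_isProductOne φ.ker (M.map List.prod) hker
      (by simpa using hlt.le)
    obtain ⟨T, hT⟩ := Multiset.le_iff_exists_add.mp hZ
    have hcard := congrArg Multiset.card hT
    rw [Multiset.card_map, Multiset.card_add] at hcard
    have hT0 : T ≠ 0 := by rintro rfl; simp at hcard; omega
    refine hS.blocks_false M ?_ hM hT hZ0 hT0 hZ1 ?_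
    · rintro b hb rfl
      exact (hblock _ hb).2.1 (by simp)
    · obtain ⟨l, rfl⟩ : ∃ l : List G, (l : Multiset G) = T := Quot.exists_rep T
      refine ⟨l, rfl, ?_⟩
      have h1 : l.prod ∈ φ.ker ⊓ commutator G := by
        refine ⟨Subgroup.list_prod_mem _ fun g hg => hker g ?_, ?_⟩
        · rw [hT]; exact Multiset.mem_add.mpr (Or.inr hg)
        · have h2 := hS.2.1.map_prod_eq_one (Abelianization.of (G := G))
          have h3 := hZ1.map_prod_eq_one (Abelianization.of (G := G))
          rw [hM, Multiset.prod_map_sum_ofList, hT, Multiset.map_add, Multiset.prod_add, h3,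
            one_mul] at h2
          have h4 : l.prod ∈ (Abelianization.of (G := G)).ker := by
            rw [MonoidHom.mem_ker, map_list_prod]
            simpa using h2
          rwa [Abelianization.ker_of] at h4
      rwa [hφ, Subgroup.mem_bot] at h1
  have hlen : 4 * Multiset.card S ≤ 3 * B * Multiset.card M := by
    rw [hM]
    clear hM hMc
    induction M using Multiset.induction_on with
    | empty => simp
    | cons b M ih =>
      have h1 := hB _ (hblock b (by simp)).2
      have h2 := ih (fun b' hb' => hblock b' (by simp [hb']))
      simp only [Multiset.map_cons, Multiset.sum_cons, Multiset.card_add, Multiset.card_cons,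
        Multiset.card_map, Multiset.coe_card] at *
      linarith
  calc _ ≤ 3 * B * Multiset.card M := hlen
    _ ≤ 3 * B * Nat.card φ.ker := Nat.mul_le_mul_left _ hMc
    _ = _ := by ring

/-- The action of a group on `ZMod q` through a character. -/
def unitAction {C : Type*} [CommGroup C] {q : ℕ} (χ : C →* (ZMod q)ˣ) :
    C →* MulAut (Multiplicative (ZMod q)) :=
  ((MulAutMultiplicative (ZMod q)).symm.toMonoidHom.comp AddAut.mulLeft).comp χ

/-- The semidirect product of `ZMod q` and `C` for the action through the character `χ`. -/
abbrev TwistedProduct {C : Type*} [CommGroup C] {q : ℕ} (χ : C →* (ZMod q)ˣ) :=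
  Multiplicative (ZMod q) ⋊[unitAction χ] C

namespace TwistedProduct

variable {C : Type*} [CommGroup C] {q : ℕ} (χ : C →* (ZMod q)ˣ)

/-- The translation part and the projection of a twisted product. -/
def twistedMap : TwistedMap (TwistedProduct χ) C q where
  ρ := SemidirectProduct.rightHom
  χ := χ.comp SemidirectProduct.rightHom
  f g := g.left.toAdd
  f_mul g h := rfl
  χ_eq_one g h := by simpa using congrArg χ h
  eq_one g h1 h2 := SemidirectProduct.ext h1 h2

theorem nat_card : Nat.card (TwistedProduct χ) = q * Nat.card C := by
  rw [SemidirectProduct.card]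
  congr 1
  exact Nat.card_zmod q

instance [NeZero q] [Finite C] : Finite (TwistedProduct χ) :=
  Finite.of_equiv _ SemidirectProduct.equivProd.symm

/-- The map onto the twisted product of the image of the character. -/
def toRange : TwistedProduct χ →* TwistedProduct χ.range.subtype :=
  SemidirectProduct.map (MonoidHom.id _) χ.rangeRestrict (fun _ => rfl)

theorem ker_toRange_inf_commutator : (toRange χ).ker ⊓ commutator (TwistedProduct χ) = ⊥ := by
  rw [eq_bot_iff]
  rintro g ⟨h1, h2⟩
  have h3 : g.right = 1 := by
    have := Abelianization.commutator_subset_ker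
      (SemidirectProduct.rightHom : TwistedProduct χ →* C) h2
    exact this
  have h4 : (toRange χ g).left = 1 := by
    rw [MonoidHom.mem_ker.mp h1]; rfl
  exact SemidirectProduct.ext h4 h3

theorem card_mul_card_ker [NeZero q] [Finite C] :
    q * Nat.card χ.range * Nat.card (toRange χ).ker = Nat.card (TwistedProduct χ) := by
  have hsurj : Function.Surjective (toRange χ) := by
    rintro ⟨v, c⟩
    obtain ⟨c', rfl⟩ := χ.rangeRestrict_surjective c
    exact ⟨⟨v, c'⟩, rfl⟩
  rw [← Subgroup.card_mul_index (toRange χ).ker, Subgroup.index_ker,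
    MonoidHom.range_eq_top.mpr hsurj, Subgroup.card_top, nat_card, mul_comm]

theorem shortAtoms_of_three_le [Fact q.Prime] [Finite C] (h : 3 ≤ Nat.card χ.range) :
    ShortAtoms (TwistedProduct χ) := by
  intro S hS
  rw [← card_mul_card_ker]
  refine hS.four_mul_card_le_of_hom (toRange χ) (ker_toRange_inf_commutator χ) fun S hS => ?_
  refine (twistedMap χ.range.subtype).four_mul_card_le (fun g hg => ?_) h ?_ hS
  · exact Subtype.ext hg
  · have h1 := Nat.card_le_card_of_injective _ χ.range.subtype_injective
    rw [Nat.card_eq_fintype_card (α := (ZMod q)ˣ), ZMod.card_units] at h1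
    have := (Fact.out : q.Prime).two_le
    omega

end TwistedProduct

theorem Multiset.exists_le_isProductOne_of_blocks {G : Type*} [Group G] (H : Subgroup G) [Finite H]
    {W : Multiset G} (M : Multiset (List G)) (hM : (M.map Multiset.ofList).sum ≤ W)
    (hb : ∀ b ∈ M, b ≠ [] ∧ b.prod ∈ H) (hc : Nat.card H ≤ card M) :
    ∃ Z ≤ W, Z ≠ 0 ∧ IsProductOne Z := by
  obtain ⟨Z, hZ, hZ0, ⟨l, rfl, hl1⟩, -⟩ := Multiset.exists_le_isProductOne H (M.map List.prod) (by
    intro g hg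
    obtain ⟨b, hbM, rfl⟩ := Multiset.mem_map.mp hg
    exact (hb b hbM).2) (by simpa using hc)
  obtain ⟨T, hT⟩ := Multiset.le_iff_exists_add.mp hZ
  obtain ⟨M₁, M₂, rfl, h1, -⟩ := Multiset.exists_map_eq_add _ _ _ _ hT
  obtain ⟨L, rfl, hL⟩ := Multiset.exists_map_eq_coe _ _ _ h1
  refine ⟨(L.flatten : Multiset G), le_trans ?_ hM, ?_, IsProductOne.of_list ?_⟩
  · rw [Multiset.coe_flatten, Multiset.map_add, Multiset.sum_add]
    exact Multiset.le_add_right _ _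
  · cases L with
    | nil => simp at hL; simp [← hL] at hZ0
    | cons b L =>
      have := (hb b (by simp)).1
      simp [this]
  · rw [List.prod_flatten, hL, hl1]

theorem Multiset.exists_pair_of_card_lt {α β : Type*} [Finite β] (κ : α → β) (V : Multiset α)
    (h : Nat.card β < card V) : ∃ x y V', V = x ::ₘ y ::ₘ V' ∧ κ x = κ y := by
  classical
  obtain ⟨l, rfl⟩ : ∃ l : List α, (l : Multiset α) = V := Quot.exists_rep V
  have hn : ¬ (l.map κ).Nodup := by
    intro hnd
    have := Fintype.ofFinite β
    have := hnd.length_le_card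
    simp [Nat.card_eq_fintype_card] at *
    omega
  obtain ⟨v, hv⟩ := List.exists_duplicate_iff_not_nodup.mpr hn
  obtain ⟨l', hl', he⟩ := List.sublist_map_iff.mp (List.duplicate_iff_sublist.mp hv)
  obtain ⟨x, l₁, rfl, hx, h1⟩ := List.map_eq_cons_iff.mp he.symm
  obtain ⟨y, l₂, rfl, hy, h2⟩ := List.map_eq_cons_iff.mp h1
  obtain rfl : l₂ = [] := by simpa using h2
  obtain ⟨V', hV'⟩ := Multiset.le_iff_exists_add.mp (Multiset.coe_le.mpr hl'.subperm)
  refine ⟨x, y, V', hV'.trans ?_, hx.trans hy.symm⟩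
  rw [← Multiset.cons_coe, ← Multiset.cons_coe]
  simp

theorem Multiset.exists_block_of_le_map {G Q : Type*} [Group G] [Group Q] (φ : G →* Q)
    {W : Multiset G} {Z : Multiset Q} (hZ : Z ≤ W.map φ) (hZ0 : Z ≠ 0) (hZ1 : IsProductOne Z) :
    ∃ b : List G, b ≠ [] ∧ (b : Multiset G) ≤ W ∧ b.prod ∈ φ.ker ∧ b.length = card Z := by
  obtain ⟨l, rfl, hl1⟩ := hZ1
  obtain ⟨T, hT⟩ := Multiset.le_iff_exists_add.mp hZ
  obtain ⟨W₁, W₂, rfl, h1, -⟩ := Multiset.exists_map_eq_add _ _ _ _ hT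
  obtain ⟨L, rfl, rfl⟩ := Multiset.exists_map_eq_coe _ _ _ h1
  refine ⟨L, by simpa using hZ0, Multiset.le_add_right _ _, ?_, by simp⟩
  rw [MonoidHom.mem_ker, map_list_prod, hl1]

namespace TwistedMap

variable {G K : Type*} [Group G] [CommGroup K] {q : ℕ} {D : TwistedMap G K q} [Fact q.Prime]

theorem chi_eq_neg_one (hχ : ∀ g, D.χ g ^ 2 = 1) {g : G} (hg : D.χ g ≠ 1) :
    (D.χ g : ZMod q) = -1 := by
  have h1 : (D.χ g : ZMod q) ^ 2 = 1 := by simpa using congrArg Units.val (hχ g)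
  rcases mul_self_eq_one_iff.mp (by rwa [sq] at h1) with h | h
  · exact absurd (Units.ext h) hg
  · exact h

/-- The terms in a complement can be reduced, up to sign, to at most one per other term. -/
theorem exists_perm_append (hχ : ∀ g, D.χ g ^ 2 = 1) (l : List G) :
    ∃ l₀ d : List G, l.Perm (l₀ ++ d) ∧ (∀ g ∈ d, D.f g = 0) ∧ D.f l₀.prod = D.f l.prod ∧
      l₀.countP (fun g => D.f g = 0) ≤ l₀.countP (fun g => D.f g ≠ 0) + 1 := by
  suffices ∃ e l₀ d : List G, l.Perm (e ++ l₀ ++ d) ∧ (∀ g ∈ d, D.f g = 0) ∧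
      (e = [] ∨ ∃ b, e = [b] ∧ D.χ b ≠ 1 ∧ D.f b = 0) ∧ D.f (e ++ l₀).prod = D.f l.prod ∧
      l₀.countP (fun g => D.f g = 0) ≤ l₀.countP (fun g => D.f g ≠ 0) by
    obtain ⟨e, l₀, d, h1, h2, h3, h4, h5⟩ := this
    refine ⟨e ++ l₀, d, h1, h2, h4, ?_⟩
    rcases h3 with rfl | ⟨b, rfl, -, hb⟩
    · exact h5.trans (Nat.le_succ _)
    · rw [List.countP_append, List.countP_append]
      simp only [List.countP_cons, List.countP_nil, hb]
      simp
      simp at h5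
      omega
  induction l with
  | nil => exact ⟨[], [], [], by simp, by simp, by simp, by simp, by simp⟩
  | cons a l ih =>
    obtain ⟨e, l₀, d, h1, h2, h3, h4, h5⟩ := ih
    by_cases ha : D.f a = 0
    · by_cases ha1 : D.χ a = 1
      · refine ⟨e, l₀, a :: d, (h1.cons a).trans List.perm_middle.symm, ?_, h3, ?_, h5⟩
        · simpa [ha] using h2
        · rw [h4, List.prod_cons, D.f_mul, ha, ha1]; simp
      · rcases h3 with rfl | ⟨b, rfl, hb1, hb⟩
        · refine ⟨[a], l₀, d, h1.cons a, h2, Or.inr ⟨a, rfl, ha1, ha⟩, ?_, h5⟩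
          rw [List.nil_append] at h4
          rw [List.singleton_append, List.prod_cons, List.prod_cons, D.f_mul, D.f_mul, h4]
        · refine ⟨[], l₀, a :: b :: d, ?_, by simpa [ha, hb] using h2, Or.inl rfl, ?_, h5⟩
          · refine (h1.cons a).trans ?_
            simp only [List.nil_append, List.cons_append]
            refine List.Perm.trans ?_ List.perm_middle.symm
            exact List.Perm.cons a List.perm_middle.symm
          · rw [List.singleton_append, List.prod_cons, D.f_mul, hb, chi_eq_neg_one hχ hb1] at h4
            rw [List.nil_append, List.prod_cons, D.f_mul, ha, chi_eq_neg_one hχ ha1, ← h4]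
            ring
    · refine ⟨[], a :: (e ++ l₀), d, h1.cons a, h2, Or.inl rfl, ?_, ?_⟩
      · rw [List.nil_append, List.prod_cons, List.prod_cons, D.f_mul, D.f_mul, h4]
      · rw [List.countP_cons, List.countP_cons, List.countP_append, List.countP_append]
        rcases h3 with rfl | ⟨b, rfl, -, hb⟩
        · simp [ha]; simp at h5; omega
        · simp [ha, hb]; simp at h5; omega

/-- The terms of an atom in a complement are bounded in terms of the other ones. -/
theorem countP_complement_le_countP_add [Finite K] (hχ : ∀ g, D.χ g ^ 2 = 1) {S : Multiset G}
    (hS : IsMinimalProductOne S) (hx : ∃ x ∈ S, D.f x ≠ 0) :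
    S.countP (fun g => D.f g = 0) ≤ S.countP (fun g => D.f g ≠ 0) + Nat.card K := by
  by_contra! hlt
  obtain ⟨l, rfl, hl1⟩ := hS.2.1
  obtain ⟨l₀, d, hperm, hd, hf, hcnt⟩ := exists_perm_append hχ l
  have hl : (l : Multiset G) = l₀ + d := by
    rw [Multiset.coe_add]; exact Multiset.coe_eq_coe.mpr hperm
  have : Finite D.complement := D.finite_complement
  have hdz : d.countP (fun g => D.f g ≠ 0) = 0 := by simpa using hd
  have hdl : d.countP (fun g => D.f g = 0) = d.length := by simpa using hd
  rw [hl] at hlt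
  simp only [Multiset.countP_add, Multiset.coe_countP, hdz, hdl] at hlt
  obtain ⟨Z, hZ, hZ0, hZ1, -⟩ := Multiset.exists_le_isProductOne D.complement (d : Multiset G)
    (by simpa using hd) (by
      have := D.card_complement_le
      simp only [Multiset.coe_card]
      omega)
  obtain ⟨U, hU⟩ := Multiset.le_iff_exists_add.mp hZ
  obtain ⟨u, rfl⟩ : ∃ u : List G, (u : Multiset G) = U := Quot.exists_rep U
  have hSeq : (l : Multiset G) = ((l₀ ++ u : List G) : Multiset G) + Z := by
    rw [hl, hU, ← Multiset.coe_add]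
    abel
  refine hS.sub_false hSeq ?_ hZ0 ⟨_, rfl, D.eq_one _ ?_ ?_⟩ hZ1
  · obtain ⟨x, hx, hx0⟩ := hx
    have : x ∈ l₀ := by
      rw [hl] at hx
      simp only [Multiset.mem_add, Multiset.mem_coe] at hx
      rcases hx with h | h
      · exact h
      · exact absurd (hd x h) hx0
    intro h0
    simp only [Multiset.coe_eq_zero, List.append_eq_nil_iff] at h0
    rw [h0.1] at this
    simp at this
  · have hu : u.prod ∈ D.complement := Subgroup.list_prod_mem _ fun g hg => hd g (by
      have : g ∈ (d : Multiset G) := by rw [hU]; simp [hg]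
      simpa using this)
    rw [List.prod_append, D.f_mul, hf, hl1, D.mem_complement.mp hu, D.f_one]
    simp
  · have h1 := rho_eq_one (D := D) hS.2.1
    have h2 := rho_eq_one (D := D) hZ1
    rw [hSeq, Multiset.map_add, Multiset.prod_add, h2, mul_one] at h1
    rw [D.rho_prod rfl, h1]

end TwistedMap

namespace TwistedProduct

variable {C : Type*} [CommGroup C] {q : ℕ} {χ : C →* (ZMod q)ˣ}

theorem mem_ker_toRange {g : TwistedProduct χ} :
    g ∈ (toRange χ).ker ↔ (twistedMap χ).f g = 0 ∧ (twistedMap χ).χ g = 1 := by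
  rw [MonoidHom.mem_ker]
  constructor
  · intro h
    exact ⟨congrArg (fun x => (SemidirectProduct.left x).toAdd) h,
      congrArg (fun x : TwistedProduct χ.range.subtype => (x.right : (ZMod q)ˣ)) h⟩
  · rintro ⟨h1, h2⟩
    exact SemidirectProduct.ext h1 (Subtype.ext h2)

theorem twistedMap_faithful (g : TwistedProduct χ.range.subtype)
    (hg : (twistedMap χ.range.subtype).χ g = 1) : (twistedMap χ.range.subtype).ρ g = 1 :=
  Subtype.ext hg

theorem chi_sq_eq_one (h2 : Nat.card χ.range = 2) (g : TwistedProduct χ) :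
    (twistedMap χ).χ g ^ 2 = 1 := by
  have h : (⟨(twistedMap χ).χ g, g.right, rfl⟩ : χ.range) ^ 2 = 1 := by
    rw [← h2]; exact pow_card_eq_one'
  exact congrArg Subtype.val h

theorem f_filter_prod (l : List (TwistedProduct χ)) [DecidablePred (· ∈ (toRange χ).ker)] :
    (twistedMap χ).f (l.filter (· ∉ (toRange χ).ker)).prod = (twistedMap χ).f l.prod := by
  induction l with
  | nil => rfl
  | cons a l ih =>
    by_cases ha : a ∈ (toRange χ).ker
    · obtain ⟨h1, h2⟩ := mem_ker_toRange.mp ha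
      rw [List.filter_cons_of_neg (by simpa using ha), ih, List.prod_cons,
        (twistedMap χ).f_mul, h1, h2]
      simp
    · rw [List.filter_cons_of_pos (by simpa using ha), List.prod_cons, List.prod_cons,
        (twistedMap χ).f_mul, (twistedMap χ).f_mul, ih]

variable [Fact q.Prime]

theorem mul_mem_ker_of_f_eq (h2 : Nat.card χ.range = 2) {x y : TwistedProduct χ}
    (hx : (twistedMap χ).χ x ≠ 1) (hy : (twistedMap χ).χ y ≠ 1)
    (h : (twistedMap χ).f x = (twistedMap χ).f y) : x * y ∈ (toRange χ).ker := by
  have hx' := TwistedMap.chi_eq_neg_one (chi_sq_eq_one h2) hx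
  have hy' := TwistedMap.chi_eq_neg_one (chi_sq_eq_one h2) hy
  refine mem_ker_toRange.mpr ⟨?_, Units.ext ?_⟩
  · rw [(twistedMap χ).f_mul, hx', h]; ring
  · rw [map_mul, Units.val_mul, hx', hy']; simp

theorem exists_pair_mem_ker (h2 : Nat.card χ.range = 2) (V : Multiset (TwistedProduct χ))
    (hV : ∀ x ∈ V, (twistedMap χ).χ x ≠ 1) (hc : q < Multiset.card V) :
    ∃ x y V', V = x ::ₘ y ::ₘ V' ∧ x * y ∈ (toRange χ).ker := by
  obtain ⟨x, y, V', rfl, h⟩ := V.exists_pair_of_card_lt (twistedMap χ).f (by simpa using hc)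
  exact ⟨x, y, V', rfl, mul_mem_ker_of_f_eq h2 (hV x (by simp)) (hV y (by simp)) h⟩

theorem exists_block (h2 : Nat.card χ.range = 2) (W : Multiset (TwistedProduct χ))
    (hW : q + 1 ≤ Multiset.card W) :
    ∃ b : List (TwistedProduct χ), b ≠ [] ∧ (b : Multiset (TwistedProduct χ)) ≤ W ∧
      b.prod ∈ (toRange χ).ker ∧ (b.length ≤ q ∨ Multiset.card W ≤ 2 * q) := by
  classical
  set D := twistedMap χ
  have hq := (Fact.out : q.Prime).two_le
  by_cases ho : q < Multiset.card (W.filter fun x => D.χ x ≠ 1)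
  · obtain ⟨x, y, V', hV, hxy⟩ := exists_pair_mem_ker h2 _
      (fun x hx => (Multiset.mem_filter.mp hx).2) ho
    refine ⟨[x, y], by simp, le_trans ?_ (Multiset.filter_le (fun x => D.χ x ≠ 1) W), by simpa using hxy,
      Or.inl (by simpa using hq)⟩
    rw [hV, ← Multiset.cons_coe, ← Multiset.cons_coe]
    simp
  by_cases hi : q < Multiset.card (W.filter fun x => ¬ D.χ x ≠ 1)
  · obtain ⟨Z, hZ, hZ0, hZ1, hZc⟩ := Multiset.exists_le_isProductOne
      (twistedMap χ.range.subtype).χ.ker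
      ((W.filter fun x => ¬ D.χ x ≠ 1).map (toRange χ)) (by
        intro g hg
        obtain ⟨x, hx, rfl⟩ := Multiset.mem_map.mp hg
        exact not_not.mp (Multiset.mem_filter.mp hx).2) (by
        have := TwistedMap.card_ker_chi_le (D := twistedMap χ.range.subtype) twistedMap_faithful
        rw [Multiset.card_map]
        omega)
    obtain ⟨b, hb, hbW, hbk, hbl⟩ := Multiset.exists_block_of_le_map _ hZ hZ0 hZ1
    have := TwistedMap.card_ker_chi_le (D := twistedMap χ.range.subtype) twistedMap_faithful
    exact ⟨b, hb, hbW.trans (Multiset.filter_le _ W), hbk, Or.inl (by omega)⟩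
  · have hsum := congrArg Multiset.card (Multiset.filter_add_not (fun x => D.χ x ≠ 1) W)
    rw [Multiset.card_add] at hsum
    obtain ⟨Z, hZ, hZ0, hZ1⟩ := TwistedMap.exists_le_isProductOne_of_card
      (D := twistedMap χ.range.subtype) twistedMap_faithful (W.map (toRange χ))
      (by rw [Multiset.card_map, h2]; omega)
    obtain ⟨b, hb, hbW, hbk, -⟩ := Multiset.exists_block_of_le_map _ hZ hZ0 hZ1
    exact ⟨b, hb, hbW, hbk, Or.inr (by omega)⟩

theorem exists_blocks (h2 : Nat.card χ.range = 2) (j : ℕ) (W : Multiset (TwistedProduct χ))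
    (hW : q * j + 1 ≤ Multiset.card W) :
    ∃ M : Multiset (List (TwistedProduct χ)), Multiset.card M = j ∧
      (M.map Multiset.ofList).sum ≤ W ∧ ∀ b ∈ M, b ≠ [] ∧ b.prod ∈ (toRange χ).ker := by
  induction j generalizing W with
  | zero => exact ⟨0, by simp⟩
  | succ j ih =>
    obtain ⟨b, hb, hbW, hbk, hbl⟩ := exists_block h2 W (by nlinarith)
    obtain ⟨U, rfl⟩ := Multiset.le_iff_exists_add.mp hbW
    have hU : j = 0 ∨ q * j + 1 ≤ Multiset.card U := by
      rw [mul_add, Multiset.card_add, Multiset.coe_card] at *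
      rcases Nat.eq_zero_or_pos j with h | h
      · exact Or.inl h
      · right
        rcases hbl with h' | h'
        · omega
        · have := Nat.mul_le_mul_left q h
          omega
    obtain ⟨M, hM, hMU, hMb⟩ : ∃ M : Multiset (List (TwistedProduct χ)), Multiset.card M = j ∧
        (M.map Multiset.ofList).sum ≤ U ∧ ∀ b ∈ M, b ≠ [] ∧ b.prod ∈ (toRange χ).ker := by
      rcases hU with rfl | hU
      · exact ⟨0, by simp⟩
      · exact ih U hU
    refine ⟨b ::ₘ M, by simp [hM], ?_, Multiset.forall_mem_cons.mpr ⟨⟨hb, hbk⟩, hMb⟩⟩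
    rw [Multiset.map_cons, Multiset.sum_cons]
    exact add_le_add le_rfl hMU

theorem exists_le_isProductOne_of_lt [Finite C] (h2 : Nat.card χ.range = 2)
    (W : Multiset (TwistedProduct χ)) (hW : q * Nat.card (toRange χ).ker < Multiset.card W) :
    ∃ Z ≤ W, Z ≠ 0 ∧ IsProductOne Z := by
  obtain ⟨M, hM, hMW, hMb⟩ := exists_blocks h2 _ W hW
  exact Multiset.exists_le_isProductOne_of_blocks _ M hMW hMb hM.ge

theorem exists_pair_blocks (h2 : Nat.card χ.range = 2) (j : ℕ) (V : Multiset (TwistedProduct χ))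
    (hV : ∀ x ∈ V, (twistedMap χ).χ x ≠ 1) (hc : q + 2 * j ≤ Multiset.card V + 1) :
    ∃ M : Multiset (List (TwistedProduct χ)), Multiset.card M = j ∧
      (M.map Multiset.ofList).sum ≤ V ∧ ∀ b ∈ M, b ≠ [] ∧ b.prod ∈ (toRange χ).ker := by
  induction j generalizing V with
  | zero => exact ⟨0, by simp⟩
  | succ j ih =>
    obtain ⟨x, y, U, rfl, hxy⟩ := exists_pair_mem_ker h2 V hV (by omega)
    simp only [Multiset.card_cons] at hc
    obtain ⟨M, hM, hMU, hMb⟩ := ih U (fun x hx => hV x (by simp [hx])) (by omega)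
    refine ⟨[x, y] ::ₘ M, by simp [hM], ?_,
      Multiset.forall_mem_cons.mpr ⟨⟨by simp, by simpa using hxy⟩, hMb⟩⟩
    rw [Multiset.map_cons, Multiset.sum_cons]
    refine (add_le_add le_rfl hMU).trans_eq ?_
    rw [show ([x, y] : List _) = x :: y :: [] from rfl, ← Multiset.cons_coe, ← Multiset.cons_coe]
    simp

theorem countP_ker_lt [Finite C] [DecidablePred (· ∈ (toRange χ).ker)]
    {S : Multiset (TwistedProduct χ)} (hS : IsMinimalProductOne S)
    (hx : ∃ x ∈ S, x ∉ (toRange χ).ker) :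
    S.countP (· ∈ (toRange χ).ker) < Nat.card (toRange χ).ker := by
  by_contra! hlt
  set D := twistedMap χ
  obtain ⟨Z, hZ, hZ0, hZ1, -⟩ := Multiset.exists_le_isProductOne (toRange χ).ker
    (S.filter (· ∈ (toRange χ).ker)) (fun g hg => (Multiset.mem_filter.mp hg).2)
    (by rwa [← Multiset.countP_eq_card_filter])
  obtain ⟨l, rfl, hl1⟩ := hS.2.1
  obtain ⟨U, hU⟩ := Multiset.le_iff_exists_add.mp hZ
  obtain ⟨u, rfl⟩ : ∃ u : List (TwistedProduct χ), (u : Multiset _) = U := Quot.exists_rep U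
  set l₀ := l.filter (· ∉ (toRange χ).ker) with hl₀
  have hSeq : (l : Multiset (TwistedProduct χ)) = ((l₀ ++ u : List _) : Multiset _) + Z := by
    rw [← Multiset.filter_add_not (· ∈ (toRange χ).ker) (l : Multiset (TwistedProduct χ)), hU,
      Multiset.filter_coe (fun x => ¬ x ∈ (toRange χ).ker), ← hl₀, ← Multiset.coe_add]
    abel
  refine hS.sub_false hSeq ?_ hZ0 ⟨_, rfl, D.eq_one _ ?_ ?_⟩ hZ1
  · obtain ⟨x, hx, hx0⟩ := hx
    intro h0
    simp only [Multiset.coe_eq_zero, List.append_eq_nil_iff] at h0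
    have : x ∈ l₀ := List.mem_filter.mpr ⟨hx, by simpa using hx0⟩
    rw [h0.1] at this
    simp at this
  · have hu : u.prod ∈ (toRange χ).ker := Subgroup.list_prod_mem _ fun g hg => by
      have : g ∈ Z + (u : Multiset _) := by simp [hg]
      rw [← hU] at this
      exact (Multiset.mem_filter.mp this).2
    rw [List.prod_append, D.f_mul, f_filter_prod, hl1, (mem_ker_toRange.mp hu).1, D.f_one]
    simp
  · have h1 := TwistedMap.rho_eq_one (D := D) hS.2.1
    have h2 := TwistedMap.rho_eq_one (D := D) hZ1
    rw [hSeq, Multiset.map_add, Multiset.prod_add, h2, mul_one] at h1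
    rw [D.rho_prod rfl, h1]

theorem card_ker_chi [Finite C] (h2 : Nat.card χ.range = 2) :
    Nat.card (twistedMap χ).χ.ker = q * Nat.card (toRange χ).ker := by
  have h := Subgroup.card_mul_index (twistedMap χ).χ.ker
  have hr : (twistedMap χ).χ.range = χ.range := by
    refine le_antisymm ?_ ?_
    · rintro _ ⟨g, rfl⟩; exact ⟨g.right, rfl⟩
    · rintro _ ⟨c, rfl⟩; exact ⟨⟨1, c⟩, rfl⟩
  rw [Subgroup.index_ker, hr, ← card_mul_card_ker, h2] at h
  nlinarith

theorem exists_spread_compl (A O : Multiset (TwistedProduct χ))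
    (hA : ∀ a ∈ A, (twistedMap χ).χ a = 1 ∧ (twistedMap χ).f a ≠ 0)
    (hO : ∀ x ∈ O, (twistedMap χ).χ x ≠ 1) (hO0 : O ≠ 0) :
    ∃ X V, O = X + V ∧ (twistedMap χ).Spread (A + X) (Multiset.card A) ∧
      Multiset.card X ≤ 1 ∧ Multiset.card X ≤ Multiset.card A := by
  rcases Multiset.empty_or_exists_mem A with rfl | ⟨a, ha⟩
  · exact ⟨0, O, by simp, TwistedMap.Spread.zero _, by simp, by simp⟩
  · obtain ⟨x, hx⟩ := Multiset.exists_mem_of_ne_zero hO0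
    obtain ⟨V, rfl⟩ := Multiset.exists_cons_of_mem hx
    refine ⟨{x}, V, by simp, TwistedMap.Spread.of_translations (hO x hx) A hA, by simp, ?_⟩
    rw [Multiset.card_singleton]
    exact Multiset.card_pos_iff_exists_mem.mpr ⟨a, ha⟩

theorem four_mul_card_le_of_card_range_eq_two [Finite C] (h2 : Nat.card χ.range = 2)
    (hr : 2 ≤ Nat.card (toRange χ).ker) : ShortAtoms (TwistedProduct χ) := by
  classical
  intro S hS
  rw [← card_mul_card_ker, h2]
  by_contra! hlt
  have hCr : Nat.card C = 2 * Nat.card (toRange χ).ker := by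
    have h := card_mul_card_ker χ
    rw [nat_card, h2, mul_assoc] at h
    exact (Nat.eq_of_mul_eq_mul_left (Fact.out : q.Prime).pos h).symm
  set D := twistedMap χ with hD
  obtain ⟨r, hrdef⟩ : ∃ r, r = Nat.card (toRange χ).ker := ⟨_, rfl⟩
  rw [← hrdef] at hr hlt hCr
  have hq : 3 ≤ q := by
    have h1 := Nat.card_le_card_of_injective _ χ.range.subtype_injective
    rw [h2, Nat.card_eq_fintype_card (α := (ZMod q)ˣ), ZMod.card_units] at h1
    omega
  have hℓ : 3 * q + 2 * r ≤ Multiset.card S + 3 := by nlinarith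
  have hℓ2 : q * r + q < Multiset.card S := by nlinarith
  have hker : Nat.card D.χ.ker = q * r := by rw [hrdef]; exact card_ker_chi h2
  set O := S.filter fun x => D.χ x ≠ 1 with hO
  set I := S.filter fun x => ¬ D.χ x ≠ 1 with hI
  set Z₀ := I.filter fun x => D.f x = 0 with hZ₀
  set A := I.filter fun x => ¬ D.f x = 0 with hA
  have hSOI : O + I = S := Multiset.filter_add_not _ S
  have hIZA : Z₀ + A = I := Multiset.filter_add_not _ I
  have hOmem : ∀ x ∈ O, D.χ x ≠ 1 := fun x hx => (Multiset.mem_filter.mp hx).2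
  have hImem : ∀ x ∈ I, D.χ x = 1 := fun x hx => not_not.mp (Multiset.mem_filter.mp hx).2
  have hAmem : ∀ a ∈ A, D.χ a = 1 ∧ D.f a ≠ 0 := fun x hx =>
    ⟨hImem x (Multiset.mem_filter.mp hx).1, (Multiset.mem_filter.mp hx).2⟩
  have hZmem : ∀ a ∈ Z₀, a ∈ (toRange χ).ker := fun x hx =>
    mem_ker_toRange.mpr ⟨(Multiset.mem_filter.mp hx).2, hImem x (Multiset.mem_filter.mp hx).1⟩
  have hcard : Multiset.card S = Multiset.card O + (Multiset.card Z₀ + Multiset.card A) := by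
    rw [← hSOI, ← hIZA, Multiset.card_add, Multiset.card_add]
  have hO0 : O ≠ 0 := by
    intro h0
    have := hS.card_le_of_subgroup D.χ.ker (fun g hg => by
      rw [← hSOI, h0, zero_add] at hg
      exact hImem g hg)
    rw [hker] at this
    omega
  obtain ⟨x, hx⟩ := Multiset.exists_mem_of_ne_zero hO0
  have hc : Multiset.card Z₀ < r := by
    rw [hrdef]
    refine lt_of_le_of_lt ?_ (countP_ker_lt hS
      ⟨x, (Multiset.mem_filter.mp hx).1, fun h => hOmem x hx (mem_ker_toRange.mp h).2⟩)
    rw [← Multiset.countP_eq_card.mpr hZmem]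
    exact Multiset.countP_le_of_le _ ((Multiset.filter_le _ _).trans (Multiset.filter_le _ _))
  by_cases hL : q ≤ Multiset.card A + 1
  · obtain ⟨A', hA', hA'c⟩ := Multiset.exists_le_card_eq_of_le A (n := q - 1) (by omega)
    have hT := TwistedMap.Spread.of_translations (D := D) (hOmem x hx) A'
      (fun a ha => hAmem a (Multiset.mem_of_le hA' ha))
    have hTS : A' + {x} ≤ S := by
      rw [← hSOI, ← hIZA, add_comm]
      exact add_le_add (Multiset.singleton_le.mpr hx) (hA'.trans (Multiset.le_add_left _ _))
    obtain ⟨W, hW⟩ := Multiset.le_iff_exists_add.mp hTS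
    have hWc := congrArg Multiset.card hW
    rw [Multiset.card_add, Multiset.card_add, Multiset.card_singleton] at hWc
    obtain ⟨Z, hZ, hZ0, hZ1⟩ := exists_le_isProductOne_of_lt h2 W (by
      rw [← hrdef]
      omega)
    exact TwistedMap.Spread.false hS hT (by omega) ((add_le_add le_rfl hZ).trans_eq hW.symm)
      hZ0 hZ1 (by simp)
  · obtain ⟨X, V, hXV, hXs, hX1, hXA⟩ := exists_spread_compl A O hAmem hOmem hO0
    have hVc := congrArg Multiset.card hXV
    rw [Multiset.card_add] at hVc
    have hVO : ∀ x ∈ V, D.χ x ≠ 1 := fun x hx => hOmem x (by rw [hXV]; simp [hx])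
    obtain ⟨T, hTV, hTc, hT⟩ := TwistedMap.exists_spread_of_matching (D := D)
      (q - 1 - Multiset.card A) V (fun x hx h => absurd h (hVO x hx)) (by omega) (by
      intro b
      cases b with
      | none =>
        rw [Multiset.countP_eq_card.mpr]
        · omega
        · intro x hx h
          exact hVO x hx (TwistedMap.fixedPoint_eq_none_iff.mp h)
      | some p =>
        by_contra! hV
        set D' := D.shift p
        have hk : S.countP (fun g => D'.f g ≠ 0) + 1 ≤ q := by
          have h1 : Z₀.countP (fun g => D'.f g ≠ 0) = 0 := by
            rw [Multiset.countP_eq_zero]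
            intro a ha h
            have := mem_ker_toRange.mp (hZmem a ha)
            apply h
            simp [D', TwistedMap.shift, D, this.1, this.2]
          have h2 := Multiset.countP_le_card (fun g => D'.f g ≠ 0) A
          have h3 := Multiset.countP_le_card (fun g => D'.f g ≠ 0) X
          have h4 : V.countP (fun g => D'.f g ≠ 0) = V.countP (fun g => D.fixedPoint g ≠ some p) := by
            refine Multiset.countP_congr rfl fun g hg => ?_
            rw [Ne, Ne, TwistedMap.fixedPoint_eq_some_iff]
            simp [hVO g hg, D']
          rw [← hSOI, ← hIZA, hXV]
          simp only [Multiset.countP_add]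
          omega
        have hk0 : ∃ x ∈ S, D'.f x ≠ 0 := by
          by_contra! h0
          have : Finite D'.complement := D'.finite_complement
          have h1 := hS.card_le_of_subgroup D'.complement (fun g hg => h0 g hg)
          have h3 := D'.card_complement_le
          omega
        have h1 := TwistedMap.countP_complement_le_countP_add (D := D') (chi_sq_eq_one h2) hS hk0
        have h3 : Multiset.card S = S.countP (fun g => D'.f g = 0) +
            S.countP (fun g => D'.f g ≠ 0) := Multiset.card_eq_countP_add_countP _ S
        omega)
    obtain ⟨R, rfl⟩ := Multiset.le_iff_exists_add.mp hTV
    rw [Multiset.card_add] at hVc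
    obtain ⟨M, hM, hMR, hMb⟩ := exists_pair_blocks h2 (r - Multiset.card Z₀) R
      (fun x hx => hVO x (by simp [hx])) (by omega)
    obtain ⟨Z, hZ, hZ0, hZ1⟩ := Multiset.exists_le_isProductOne_of_blocks (toRange χ).ker
      (W := R + Z₀) (M + Z₀.map fun x => [x]) (by
        rw [Multiset.map_add, Multiset.sum_add]
        refine add_le_add hMR ?_
        rw [Multiset.map_map]
        exact (Multiset.sum_map_singleton Z₀).le) (by
        intro b hb
        rcases Multiset.mem_add.mp hb with hb | hb
        · exact hMb b hb
        · obtain ⟨a, ha, rfl⟩ := Multiset.mem_map.mp hb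
          exact ⟨by simp, by simpa using hZmem a ha⟩) (by
        rw [Multiset.card_add, Multiset.card_map, ← hrdef]
        omega)
    refine TwistedMap.Spread.false hS (hXs.add hT) (by omega) (Z := Z) ?_ hZ0 hZ1 ?_
    · refine (add_le_add le_rfl hZ).trans_eq ?_
      rw [← hSOI, ← hIZA, hXV]
      abel
    · intro h0
      have := congrArg Multiset.card h0
      rw [Multiset.card_add, hTc] at this
      simp at this
      omega

end TwistedProduct

open scoped IsMulCommutative in
theorem IsZGroup.eq_one_of_mem_center {G : Type*} [Group G] [Finite G] [IsZGroup G] {c : G}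
    (h1 : c ∈ Subgroup.center G) (h2 : c ∈ commutator G) : c = 1 := by
  have := IsZGroup.isCyclic_commutator G
  have h3 : c ∈ (MonoidHom.transfer (MonoidHom.id (commutator G))).ker :=
    Abelianization.commutator_subset_ker _ h2
  have h4 : c ^ (commutator G).index = 1 := by
    rw [MonoidHom.mem_ker, MonoidHom.transfer_eq_pow _ c ?_] at h3
    · exact congrArg Subtype.val h3
    · intro k g _
      have := Subgroup.mem_center_iff.mp (Subgroup.pow_mem _ h1 k) g
      rw [mul_assoc, ← this, inv_mul_cancel_left]
  have h5 : orderOf c ∣ Nat.card (commutator G) := Subgroup.orderOf_dvd_natCard _ h2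
  exact orderOf_eq_one_iff.mp <| Nat.eq_one_of_dvd_coprimes (IsZGroup.coprime_commutator_index G)
    h5 (orderOf_dvd_of_pow_eq_one h4)

theorem exists_hom_zmod {G : Type*} [Group G] (g : G) {n : ℕ} (hn : orderOf g = n) :
    ∃ β : Multiplicative (ZMod n) →* G, Function.Injective β ∧
      ∀ k : ℤ, β (.ofAdd (k : ZMod n)) = g ^ k := by
  let f : {f : ℤ →+ Additive G // f n = 0} := ⟨zmultiplesHom _ (Additive.ofMul g), by
    rw [zmultiplesHom_apply, ← ofMul_zpow, zpow_natCast, ← hn, pow_orderOf_eq_one]; rfl⟩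
  refine ⟨(ZMod.lift n f).toMultiplicativeLeft, ?_, fun k => ?_⟩
  · have : Function.Injective (ZMod.lift n f) := by
      refine (ZMod.lift_injective n).mpr fun m hm => ?_
      change Additive.ofMul (g ^ m) = 0 at hm
      rw [ofMul_eq_zero] at hm
      rw [ZMod.intCast_zmod_eq_zero_iff_dvd, ← hn]
      exact orderOf_dvd_iff_zpow_eq_one.mpr hm
    exact this
  · exact ZMod.lift_coe n f k

/-- A subgroup of prime order normalized by an abelian group of coprime order gives rise to a
twisted product. -/
theorem exists_twistedProduct {G C : Type*} [Group G] [CommGroup C] [Finite C] {q : ℕ}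
    [Fact q.Prime] (κ : C →* G) (hκ : Function.Injective κ) {b : G} (hb : orderOf b = q)
    (hn : ∀ c, κ c * b * (κ c)⁻¹ ∈ Subgroup.zpowers b) (hq : q.Coprime (Nat.card C)) :
    ∃ χ : C →* (ZMod q)ˣ, (∀ c, χ c = 1 → κ c * b * (κ c)⁻¹ = b) ∧
      ∃ ι : TwistedProduct χ →* G, Function.Injective ι := by
  obtain ⟨β, hβ, hβb⟩ := exists_hom_zmod b hb
  have hb1 : β (.ofAdd 1) = b := by simpa using hβb 1
  have hex : ∀ c, ∃ k : ZMod q, κ c * b * (κ c)⁻¹ = β (.ofAdd k) := by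
    intro c
    obtain ⟨k, hk⟩ := hn c
    exact ⟨k, by rw [hβb]; exact hk.symm⟩
  choose k hk using hex
  have hconj : ∀ c v, κ c * β (.ofAdd v) * (κ c)⁻¹ = β (.ofAdd (k c * v)) := by
    intro c v
    obtain ⟨m, rfl⟩ := ZMod.intCast_surjective v
    rw [hβb, ← conj_zpow, hk, ← map_zpow, ← ofAdd_zsmul, zsmul_eq_mul, mul_comm]
  have hval : ∀ {c v}, κ c * b * (κ c)⁻¹ = β (.ofAdd v) → k c = v := fun h =>
    Multiplicative.ofAdd.injective (hβ ((hk _).symm.trans h))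
  let χ : C →* (ZMod q)ˣ := MonoidHom.toHomUnits
    { toFun := k
      map_one' := hval (by rw [hb1]; simp)
      map_mul' := fun c d => hval (by
        rw [← hconj, ← hk, map_mul]
        group) }
  have hχ : ∀ c, (χ c : ZMod q) = k c := fun c => rfl
  refine ⟨χ, fun c hc => ?_, SemidirectProduct.lift β κ ?_, ?_⟩
  · rw [hk, ← hχ, hc, Units.val_one, hb1]
  · intro c
    ext v
    exact (hconj c v).symm
  · rw [injective_iff_map_eq_one]
    rintro ⟨v, c⟩ h
    replace h : β v * κ c = 1 := h
    have h1 : β v = (κ c)⁻¹ := eq_inv_of_mul_eq_one_left h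
    have h2 : orderOf (β v) ∣ q := by
      rw [orderOf_injective β hβ]
      simpa using orderOf_dvd_natCard v
    have h3 : orderOf (β v) ∣ Nat.card C := by
      rw [h1, orderOf_inv, orderOf_injective κ hκ]
      exact orderOf_dvd_natCard c
    have h4 : β v = 1 := orderOf_eq_one_iff.mp (Nat.eq_one_of_dvd_coprimes hq h2 h3)
    have h5 : v = 1 := hβ (h4.trans (map_one β).symm)
    have h6 : c = 1 := hκ (by rw [h4, one_mul] at h; rw [h, map_one])
    rw [h5, h6]; rfl

theorem TwistedProduct.shortAtoms_of_card_ne_two {C : Type*} [CommGroup C] [Finite C] {q : ℕ}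
    [Fact q.Prime] {χ : C →* (ZMod q)ˣ} (hχ : χ ≠ 1) (hC : Nat.card C ≠ 2) :
    ShortAtoms (TwistedProduct χ) := by
  have h1 : Nat.card χ.range ≠ 1 := by
    rw [Ne, Subgroup.card_eq_one, MonoidHom.range_eq_bot_iff]
    exact hχ
  have h0 : 0 < Nat.card χ.range := Nat.card_pos
  rcases (show Nat.card χ.range = 2 ∨ 3 ≤ Nat.card χ.range by omega) with h2 | h3
  · refine four_mul_card_le_of_card_range_eq_two h2 ?_
    have h := card_mul_card_ker χ
    rw [nat_card, h2, mul_assoc] at h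
    have := Nat.eq_of_mul_eq_mul_left (Fact.out : q.Prime).pos h
    have : 0 < Nat.card (toRange χ).ker := Nat.card_pos
    omega
  · exact shortAtoms_of_three_le χ h3

theorem exists_mulEquiv_dihedralGroup {G : Type*} [Group G] [Finite G] {a y : G} {n : ℕ}
    (ha : orderOf a = n) (hy : y * y = 1) (hya : y * a * y⁻¹ = a⁻¹)
    (hy1 : y ∉ Subgroup.zpowers a) (hG : Nat.card G = 2 * n) :
    Nonempty (G ≃* DihedralGroup n) := by
  obtain ⟨β, hβ, hβb⟩ := exists_hom_zmod a ha
  have hn : NeZero n := ⟨by rw [← ha]; exact (orderOf_pos a).ne'⟩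
  have hconj : ∀ v : ZMod n, β (.ofAdd v) * y = y * β (.ofAdd (-v)) := by
    intro v
    obtain ⟨m, rfl⟩ := ZMod.intCast_surjective v
    have h : y * a ^ m * y⁻¹ = (a ^ m)⁻¹ := by rw [← conj_zpow, hya, inv_zpow]
    rw [ofAdd_neg, map_inv, hβb, ← h, inv_eq_of_mul_eq_one_left hy, mul_assoc y (a ^ m),
      ← mul_assoc y y, hy, one_mul]
  have hadd : ∀ v w : ZMod n, β (.ofAdd (v + w)) = β (.ofAdd v) * β (.ofAdd w) := fun v w => by
    rw [ofAdd_add, map_mul]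
  let F : DihedralGroup n → G := fun x => match x with
    | .r i => β (.ofAdd i)
    | .sr i => y * β (.ofAdd i)
  have hFr : ∀ i, F (.r i) = β (.ofAdd i) := fun _ => rfl
  have hFs : ∀ i, F (.sr i) = y * β (.ofAdd i) := fun _ => rfl
  let Φ : DihedralGroup n →* G := MonoidHom.mk' F (by
    rintro (i | i) (j | j)
    · simp only [DihedralGroup.r_mul_r, hFr, hadd]
    · rw [DihedralGroup.r_mul_sr, hFs, hFs, hFr, ← mul_assoc, hconj, mul_assoc, ← hadd]
      congr 3
      ring
    · rw [DihedralGroup.sr_mul_r, hFs, hFs, hFr, hadd, mul_assoc]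
    · rw [DihedralGroup.sr_mul_sr, hFs, hFs, hFr, mul_assoc, ← mul_assoc _ y, hconj, mul_assoc,
        ← hadd, ← mul_assoc, hy, one_mul]
      congr 2
      ring)
  have hinj : Function.Injective Φ := by
    rw [injective_iff_map_eq_one]
    rintro (i | i) h
    · have : Multiplicative.ofAdd i = 1 := hβ (Eq.trans h (map_one β).symm)
      rw [DihedralGroup.one_def]
      exact congrArg DihedralGroup.r this
    · exfalso
      apply hy1
      replace h : y * β (.ofAdd i) = 1 := h
      rw [eq_inv_of_mul_eq_one_left h, ← map_inv, ← ofAdd_neg]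
      obtain ⟨m, hm⟩ := ZMod.intCast_surjective (-i)
      rw [← hm, hβb]
      exact ⟨m, rfl⟩
  have hbij : Function.Bijective Φ := by
    rw [Nat.bijective_iff_injective_and_card]
    exact ⟨hinj, by rw [hG, DihedralGroup.nat_card]⟩
  exact ⟨(MulEquiv.ofBijective Φ hbij).symm⟩

open scoped IsMulCommutative in
theorem IsZGroup.shortAtoms {G : Type*} [Group G] [Finite G] [IsZGroup G] (hcyc : ¬ IsCyclic G)
    (hdih : ¬ ∃ n : ℕ, Odd n ∧ Nonempty (G ≃* DihedralGroup n)) : ShortAtoms G := by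
  have hcop := IsZGroup.coprime_commutator_index G
  have hNc := IsZGroup.isCyclic_commutator G
  obtain ⟨H, hH⟩ := Subgroup.exists_right_complement'_of_coprime hcop
  have hab : IsCyclic (G ⧸ commutator G) := IsZGroup.isCyclic_abelianization
  have hHc : IsCyclic H :=
    isCyclic_of_surjective hH.symm.QuotientMulEquiv hH.symm.QuotientMulEquiv.surjective
  have hHi : (commutator G).index = Nat.card H := hH.symm.index_eq_card
  obtain ⟨⟨a, haN⟩, ha⟩ := hNc.exists_generator
  have hzp : Subgroup.zpowers a = commutator G := by
    refine le_antisymm (by simpa using haN) fun x hx => ?_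
    obtain ⟨k, hk⟩ := ha ⟨x, hx⟩
    exact ⟨k, congrArg Subtype.val hk⟩
  have hacard : orderOf a = Nat.card (commutator G) := by rw [← hzp, Nat.card_zpowers]
  have hcomm : ∀ x ∈ commutator G, ∀ y ∈ commutator G, x * y = y * x := fun x hx y hy =>
    congrArg Subtype.val (mul_comm (⟨x, hx⟩ : commutator G) ⟨y, hy⟩)
  have hcenter : ∀ x ∈ commutator G, (∀ h ∈ H, h * x = x * h) → x = 1 := by
    intro x hx hxH
    refine IsZGroup.eq_one_of_mem_center (Subgroup.mem_center_iff.mpr fun g => ?_) hx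
    obtain ⟨⟨u, h⟩, rfl⟩ := hH.surjective g
    change (u : G) * h * x = x * (u * h)
    rw [mul_assoc, hxH h h.2, ← mul_assoc, ← mul_assoc, hcomm u u.2 x hx]
  by_cases hN1 : Nat.card (commutator G) = 1
  · exfalso
    apply hcyc
    have hH' : H = ⊤ := Subgroup.eq_top_of_card_eq H (by
      rw [← hHi, ← Subgroup.card_mul_index (commutator G), hN1, one_mul])
    subst hH'
    exact isCyclic_of_surjective Subgroup.topEquiv (MulEquiv.surjective _)
  by_cases hH2 : Nat.card H = 2
  · exfalso
    apply hdih
    obtain ⟨⟨y, hyH⟩, hy⟩ := hHc.exists_generator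
    have hodd : Odd (Nat.card (commutator G)) := by
      rw [hHi, hH2] at hcop
      exact Nat.Coprime.odd_of_right hcop
    have hy2 : y * y = 1 := by
      have h : (⟨y, hyH⟩ : H) ^ Nat.card H = 1 := pow_card_eq_one'
      rw [hH2, sq] at h
      exact congrArg Subtype.val h
    have hya : y * a * y⁻¹ ∈ commutator G := Subgroup.Normal.conj_mem inferInstance a haN y
    have hc : a * (y * a * y⁻¹) = 1 := by
      refine hcenter _ (mul_mem haN hya) fun h hh => ?_
      obtain ⟨k, hk⟩ := hy ⟨h, hh⟩
      obtain rfl : y ^ k = h := congrArg Subtype.val hk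
      have hcy : Commute y (a * (y * a * y⁻¹)) := by
        change y * (a * (y * a * y⁻¹)) = a * (y * a * y⁻¹) * y
        have hyi : y⁻¹ = y := inv_eq_of_mul_eq_one_left hy2
        have := hcomm _ hya a haN
        rw [hyi] at this ⊢
        calc y * (a * (y * a * y)) = (y * a * y * a) * y := by simp only [mul_assoc]
          _ = a * (y * a * y) * y := by rw [this]
      exact hcy.zpow_left k
    refine ⟨orderOf a, hacard ▸ hodd, exists_mulEquiv_dihedralGroup rfl hy2
      (eq_inv_of_mul_eq_one_right hc) ?_ ?_⟩
    · intro hyz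
      rw [hzp] at hyz
      have h1 : (⟨y, hyH⟩ : H) = 1 := by
        have : y ∈ commutator G ⊓ H := ⟨hyz, hyH⟩
        rw [hH.isCompl.inf_eq_bot] at this
        exact Subtype.ext this
      have := orderOf_eq_card_of_forall_mem_zpowers hy
      rw [h1, orderOf_one] at this
      omega
    · rw [hacard, ← Subgroup.card_mul_index (commutator G), hHi, hH2, mul_comm]
  · obtain ⟨q, hq, hqd⟩ := Nat.exists_prime_and_dvd hN1
    have := Fact.mk hq
    set m := Nat.card (commutator G) / q with hm
    have hmq : m * q = Nat.card (commutator G) := Nat.div_mul_cancel hqd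
    have hb : orderOf (a ^ m) = q := by
      have hm0 : m ≠ 0 := by
        rintro h0
        rw [h0, zero_mul] at hmq
        exact Nat.card_pos.ne hmq
      rw [orderOf_pow_of_dvd hm0 (by rw [hacard, ← hmq]; exact dvd_mul_right _ _), hacard, ← hmq,
        Nat.mul_div_cancel_left _ (Nat.pos_of_ne_zero hm0)]
    have hbN : a ^ m ∈ commutator G := Subgroup.pow_mem _ haN m
    obtain ⟨χ, hχ, ι, hι⟩ := exists_twistedProduct H.subtype H.subtype_injective hb
      (fun c => by
        have : (c : G) * a * (c : G)⁻¹ ∈ commutator G :=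
          Subgroup.Normal.conj_mem inferInstance a haN c
        rw [← hzp] at this
        obtain ⟨k, hk⟩ := this
        refine ⟨k, ?_⟩
        rw [Subgroup.subtype_apply, ← conj_pow, ← hk]
        simp only [← zpow_natCast, ← zpow_mul, mul_comm])
      (Nat.Coprime.of_dvd_left hqd (hHi ▸ hcop))
    refine ShortAtoms.of_injective ι hι (TwistedProduct.shortAtoms_of_card_ne_two ?_ hH2)
    rintro rfl
    have := hcenter _ hbN fun h hh => by
      have := hχ ⟨h, hh⟩ rfl
      exact mul_inv_eq_iff_eq_mul.mp this
    rw [this, orderOf_one] at hb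
    exact hq.one_lt.ne hb

open MvPolynomial in
theorem exists_sum_eq_zero_of_card {p : ℕ} [Fact p.Prime] {σ : Type*} [Fintype σ]
    (a b : σ → ZMod p) (h : 2 * p ≤ Fintype.card σ + 1) :
    ∃ I : Finset σ, I.Nonempty ∧ ∑ i ∈ I, a i = 0 ∧ ∑ i ∈ I, b i = 0 := by
  classical
  have hp := (Fact.out : p.Prime).two_le
  let F : (σ → ZMod p) → MvPolynomial σ (ZMod p) := fun a => ∑ i, a i • X i ^ (p - 1)
  have hF : ∀ a, (F a).totalDegree ≤ p - 1 := fun a => by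
    apply totalDegree_finsetSum_le
    rintro i -
    exact (totalDegree_smul_le ..).trans (totalDegree_X_pow ..).le
  have hev : ∀ a x, eval x (F a) = ∑ i ∈ Finset.univ.filter (fun i => x i ≠ 0), a i := fun a x => by
    simp [F, ZMod.pow_card_sub_one, Finset.sum_filter]
  have hdvd := char_dvd_card_solutions_of_add_lt p (f₁ := F a) (f₂ := F b)
    (by have := hF a; have := hF b; omega)
  let z : {x // eval x (F a) = 0 ∧ eval x (F b) = 0} := ⟨0, by rw [hev, hev]; simp⟩
  obtain ⟨x, hx⟩ := Fintype.exists_ne_of_one_lt_card ((Fact.out : p.Prime).one_lt.trans_le <|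
    Nat.le_of_dvd (Fintype.card_pos_iff.mpr ⟨z⟩) hdvd) z
  refine ⟨Finset.univ.filter (fun i => x.1 i ≠ 0), ?_, (hev a x).symm.trans x.2.1,
    (hev b x).symm.trans x.2.2⟩
  rw [← Subtype.coe_ne_coe, Function.ne_iff] at hx
  obtain ⟨i, hi⟩ := hx
  exact ⟨i, by simpa [z] using hi⟩

theorem shortAtoms_zmod_prod (p : ℕ) [Fact p.Prime] :
    ShortAtoms (Multiplicative (ZMod p) × Multiplicative (ZMod p)) := by
  classical
  have hp := (Fact.out : p.Prime).two_le
  intro S hS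
  have hcard : Nat.card (Multiplicative (ZMod p) × Multiplicative (ZMod p)) = p * p := by
    rw [Nat.card_prod]
    congr 1 <;> exact Nat.card_zmod p
  rw [hcard]
  suffices h : Multiset.card S + 1 ≤ 2 * p by nlinarith
  by_contra! hlt
  obtain ⟨l, rfl, hl1⟩ := hS.2.1
  cases l with
  | nil => simp at hlt; omega
  | cons g l =>
    simp only [Multiset.coe_card, List.length_cons] at hlt
    obtain ⟨I, hI, ha, hb⟩ := exists_sum_eq_zero_of_card (fun i => (l.get i).1.toAdd)
      (fun i => (l.get i).2.toAdd) (by rw [Fintype.card_fin]; omega)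
    have hprod : (I.val.map l.get).prod = 1 := by
      change ∏ i ∈ I, l.get i = 1
      refine Prod.ext ?_ ?_
      · rw [Prod.fst_prod]
        exact ha
      · rw [Prod.snd_prod]
        exact hb
    have hle : I.val.map l.get ≤ (l : Multiset _) := by
      have h := Multiset.map_le_map (f := l.get) (Finset.val_le_iff.mpr I.subset_univ)
      rwa [Fin.univ_val_map, List.ofFn_get] at h
    obtain ⟨U, hU⟩ := Multiset.le_iff_exists_add.mp hle
    have hone : ∀ T : Multiset (Multiplicative (ZMod p) × Multiplicative (ZMod p)),
        T.prod = 1 → IsProductOne T := by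
      intro T hT
      induction T using Quot.inductionOn with | _ t => ?_
      exact ⟨t, rfl, by simpa using hT⟩
    refine hS.sub_false (T := g ::ₘ U) (Z := I.val.map l.get) ?_ (by simp) ?_ (hone _ ?_)
      (hone _ hprod)
    · rw [← Multiset.cons_coe, hU, Multiset.cons_add, add_comm]
    · simpa using hI.ne_empty
    · have h := congrArg Multiset.prod hU
      rw [Multiset.prod_add, hprod, one_mul, Multiset.prod_coe] at h
      rw [Multiset.prod_cons, ← h, ← List.prod_cons, hl1]

theorem ShortAtoms.of_commute {G : Type*} [Group G] [Finite G] {p : ℕ} [Fact p.Prime] {x y : G}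
    (hx : orderOf x = p) (hy : orderOf y = p) (hxy : Commute x y)
    (h : y ∉ Subgroup.zpowers x) : ShortAtoms G := by
  obtain ⟨β, hβ, hβx⟩ := exists_hom_zmod x hx
  obtain ⟨γ, hγ, hγy⟩ := exists_hom_zmod y hy
  have hβr : ∀ v : Multiplicative (ZMod p), ∃ k : ℤ, β v = x ^ k := fun v => by
    obtain ⟨k, hk⟩ := ZMod.intCast_surjective v.toAdd
    exact ⟨k, by rw [← hβx, hk, ofAdd_toAdd]⟩
  have hγr : ∀ v : Multiplicative (ZMod p), ∃ k : ℤ, γ v = y ^ k := fun v => by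
    obtain ⟨k, hk⟩ := ZMod.intCast_surjective v.toAdd
    exact ⟨k, by rw [← hγy, hk, ofAdd_toAdd]⟩
  have hcomm : ∀ u v, Commute (β u) (γ v) := fun u v => by
    obtain ⟨k, hk⟩ := hβr u
    obtain ⟨m, hm⟩ := hγr v
    rw [hk, hm]
    exact (hxy.zpow_left k).zpow_right m
  refine ShortAtoms.of_injective (β.noncommCoprod γ hcomm) ?_ (shortAtoms_zmod_prod p)
  rw [MonoidHom.noncommCoprod_injective]
  refine ⟨hβ, hγ, Subgroup.disjoint_def.mpr ?_⟩
  rintro g ⟨u, rfl⟩ ⟨v, hv⟩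
  obtain ⟨k, hk⟩ := hβr u
  obtain ⟨m, hm⟩ := hγr v
  by_contra hne
  have hm0 : (orderOf (y ^ m)) = p := by
    refine orderOf_eq_prime ?_ ?_
    · rw [← zpow_natCast, zpow_comm, zpow_natCast, ← hy, pow_orderOf_eq_one, one_zpow]
    · rw [← hm, hv]; exact hne
  have hle : Subgroup.zpowers (y ^ m) = Subgroup.zpowers y :=
    Subgroup.eq_of_le_of_card_ge (Subgroup.zpowers_le.mpr (Subgroup.zpow_mem_zpowers y m)) (by
      rw [Nat.card_zpowers, Nat.card_zpowers, hm0, hy])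
  apply h
  have : y ∈ Subgroup.zpowers (y ^ m) := hle ▸ Subgroup.mem_zpowers y
  rw [← hm, hv, hk] at this
  exact Subgroup.zpowers_le.mpr (Subgroup.zpow_mem_zpowers x k) this

theorem Multiset.exists_le_isProductOne_of_sq_eq_one {Q : Type*} [Group Q] (hQ : Nat.card Q = 4)
    (hsq : ∀ g : Q, g * g = 1) (V : Multiset Q) (hV : 3 ≤ card V) :
    ∃ Z ≤ V, Z ≠ 0 ∧ IsProductOne Z := by
  classical
  have : Finite Q := Nat.finite_of_card_ne_zero (by omega)
  have := Fintype.ofFinite Q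
  obtain ⟨T, hT, hT3⟩ := Multiset.exists_le_card_eq_of_le V hV
  obtain ⟨a, b, c, rfl⟩ := Multiset.card_eq_three.mp hT3
  suffices ∃ l : List Q, (l : Multiset Q) ≤ {a, b, c} ∧ l ≠ [] ∧ l.prod = 1 by
    obtain ⟨l, h1, h2, h3⟩ := this
    exact ⟨l, h1.trans hT, by simpa using h2, IsProductOne.of_list h3⟩
  have hle : ∀ l : List Q, l.Subperm [a, b, c] → (l : Multiset Q) ≤ {a, b, c} := fun l h =>
    Multiset.coe_le.mpr h
  by_cases ha : a = 1
  · exact ⟨[a], hle _ (by simp), by simp, by simpa using ha⟩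
  by_cases hb : b = 1
  · exact ⟨[b], hle _ (by simp), by simp, by simpa using hb⟩
  by_cases hc : c = 1
  · exact ⟨[c], hle _ (by simp), by simp, by simpa using hc⟩
  by_cases hab : a = b
  · exact ⟨[a, b], hle _ (List.Sublist.subperm (by simp)), by simp, by simp [hab, hsq]⟩
  by_cases hac : a = c
  · exact ⟨[a, c], hle _ (List.Sublist.subperm (by simp)), by simp, by simp [hac, hsq]⟩
  by_cases hbc : b = c
  · exact ⟨[b, c], hle _ (List.Sublist.subperm (by simp)), by simp, by simp [hbc, hsq]⟩
  refine ⟨[a, b, c], hle _ (List.Subperm.refl _), by simp, ?_⟩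
  by_contra habc
  have hnd : [1, a, b, c, a * b].Nodup := by
    simp only [List.nodup_cons, List.mem_cons, List.not_mem_nil, or_false, not_or,
      not_false_eq_true, List.nodup_nil, and_true]
    refine ⟨⟨Ne.symm ha, Ne.symm hb, Ne.symm hc, fun h => hab ?_⟩, ⟨hab, hac, ?_⟩, ⟨hbc, ?_⟩, ?_⟩
    · exact (eq_inv_of_mul_eq_one_left h.symm).trans (inv_eq_of_mul_eq_one_left (hsq b))
    · simpa using hb
    · simpa using ha
    · rintro rfl
      apply habc
      simpa [mul_assoc] using hsq (a * b)
  have := hnd.length_le_card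
  rw [← Nat.card_eq_fintype_card, hQ] at this
  simp at this

theorem ShortAtoms.of_card_eq_eight {G : Type*} [Group G] [Finite G] (hG : Nat.card G = 8)
    (hcomm : ∃ x y : G, x * y ≠ y * x) : ShortAtoms G := by
  classical
  have hpG : IsPGroup 2 G := IsPGroup.of_card (n := 3) (by rw [hG]; norm_num)
  have hnc : ¬ IsCyclic (G ⧸ Subgroup.center G) := fun hc => by
    obtain ⟨x, y, hxy⟩ := hcomm
    exact hxy ((MonoidHom.isMulCommutative_of_isCyclic_of_ker_le_center
      (QuotientGroup.mk' (Subgroup.center G)) (by rw [QuotientGroup.ker_mk'])).is_comm.comm x y)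
  have hmul := Subgroup.card_mul_index (Subgroup.center G)
  rw [hG] at hmul
  have hZ : Nat.card (Subgroup.center G) = 2 ∧ (Subgroup.center G).index = 4 := by
    have : Nontrivial G := Finite.one_lt_card_iff_nontrivial.mp (by omega)
    have : Nontrivial (Subgroup.center G) := hpG.center_nontrivial
    have h1 : 1 < Nat.card (Subgroup.center G) := Finite.one_lt_card
    have h2 : (Subgroup.center G).index ≠ 1 := fun h => hnc <| by
      have := (Nat.card_eq_one_iff_unique.mp h).1
      infer_instance
    have h3 : (Subgroup.center G).index ≠ 2 := fun h => hnc <| by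
      have : Fact (Nat.Prime 2) := ⟨Nat.prime_two⟩
      exact isCyclic_of_prime_card (p := 2) h
    have h4 : (Subgroup.center G).index ≠ 3 := by
      intro h
      rw [h] at hmul
      omega
    have h5 : (Subgroup.center G).index < 5 := by nlinarith
    have h6 : (Subgroup.center G).index ≠ 0 := Subgroup.index_ne_zero_of_finite
    interval_cases h : (Subgroup.center G).index <;> omega
  obtain ⟨hZ2, hZi⟩ := hZ
  set π := QuotientGroup.mk' (Subgroup.center G) with hπ
  have hπk : ∀ g, π g = 1 ↔ g ∈ Subgroup.center G := fun g => QuotientGroup.eq_one_iff g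
  have hexp : Monoid.exponent (G ⧸ Subgroup.center G) = 2 :=
    (not_isCyclic_iff_exponent_eq_prime Nat.prime_two (by rw [← Subgroup.index, hZi]; norm_num)).mp hnc
  have hsq : ∀ g : G ⧸ Subgroup.center G, g * g = 1 := fun g => by
    rw [← sq, ← hexp, Monoid.pow_exponent_eq_one]
  have hQc : ∀ g h : G ⧸ Subgroup.center G, g * h = h * g := mul_comm_of_exponent_two hexp
  let _ : CommGroup (G ⧸ Subgroup.center G) := { mul_comm := hQc }
  have hsub : ∀ W : Multiset G, 5 ≤ Multiset.card W → ∃ Z ≤ W, Z ≠ 0 ∧ IsProductOne Z := by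
    intro W hW
    obtain ⟨x, y, V, rfl, hxy⟩ := W.exists_pair_of_card_lt π (by
      rw [← Subgroup.index, hZi]; omega)
    simp only [Multiset.card_cons] at hW
    obtain ⟨Z, hZ, hZ0, hZ1⟩ := Multiset.exists_le_isProductOne_of_sq_eq_one (by
      rw [← Subgroup.index, hZi]) hsq (V.map π) (by rw [Multiset.card_map]; omega)
    obtain ⟨b, hb, hbV, hbk, -⟩ := Multiset.exists_block_of_le_map π hZ hZ0 hZ1
    refine Multiset.exists_le_isProductOne_of_blocks (Subgroup.center G) {[x, y], b} ?_ ?_ ?_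
    · rw [show ({[x, y], b} : Multiset (List G)) = [x, y] ::ₘ {b} from rfl, Multiset.map_cons,
        Multiset.map_singleton, Multiset.sum_cons, Multiset.sum_singleton,
        show ([x, y] : List G) = x :: y :: [] from rfl, ← Multiset.cons_coe, ← Multiset.cons_coe]
      rw [Multiset.cons_add, Multiset.cons_add, Multiset.coe_nil, zero_add]
      exact Multiset.cons_le_cons _ (Multiset.cons_le_cons _ hbV)
    · intro c hc
      rw [Multiset.insert_eq_cons, Multiset.mem_cons, Multiset.mem_singleton] at hc
      rcases hc with rfl | rfl
      · refine ⟨by simp, (hπk _).mp ?_⟩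
        simp only [List.prod_cons, List.prod_nil, mul_one, map_mul, hxy, hsq]
      · exact ⟨hb, (hπk _).mp hbk⟩
    · simp [hZ2]
  intro S hS
  rw [hG]
  by_contra! hlt
  by_cases hS' : ∀ x ∈ S, ∀ y ∈ S, x * y = y * x
  · obtain ⟨W, hW, hW5⟩ := Multiset.exists_le_card_eq_of_le S (n := 5) (by omega)
    obtain ⟨Z, hZ, hZ0, hZ1⟩ := hsub W hW5.ge
    obtain ⟨U, hU⟩ := Multiset.le_iff_exists_add.mp (hZ.trans hW)
    have hZc := Multiset.card_le_card hZ
    refine hS.sub_false (hU.trans (add_comm _ _)) ?_ hZ0 ?_ hZ1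
    · rintro rfl
      rw [hU, add_zero] at hlt
      omega
    · obtain ⟨l, hl, hl1⟩ := hS.2.1
      obtain ⟨z, hz, hz1⟩ := hZ1
      obtain ⟨u, rfl⟩ : ∃ u : List G, (u : Multiset G) = U := Quot.exists_rep U
      have hperm : l.Perm (z ++ u) := by
        rw [← Multiset.coe_eq_coe, ← Multiset.coe_add, hl, hz, hU]
      have := hperm.prod_eq' (List.pairwise_of_forall_mem_list fun a ha b hb =>
        hS' a (by rw [← hl]; exact ha) b (by rw [← hl]; exact hb))
      rw [hl1, List.prod_append, hz1, one_mul] at this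
      exact ⟨u, rfl, this.symm⟩
  · push Not at hS'
    obtain ⟨x, hx, y, hy, hxy⟩ := hS'
    obtain ⟨S', rfl⟩ := Multiset.exists_cons_of_mem hx
    have hyx : y ∈ S' := by
      rcases Multiset.mem_cons.mp hy with rfl | h
      · exact absurd rfl hxy
      · exact h
    obtain ⟨W, rfl⟩ := Multiset.exists_cons_of_mem hyx
    simp only [Multiset.card_cons] at hlt
    obtain ⟨Z, hZ, hZ0, hZ1⟩ := hsub W (by omega)
    obtain ⟨R, rfl⟩ := Multiset.le_iff_exists_add.mp hZ
    have hmap : ∀ {T : Multiset G}, IsProductOne T → (T.map π).prod = 1 := by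
      rintro T ⟨l, rfl, hl⟩
      rw [Multiset.map_coe, Multiset.prod_coe, ← map_list_prod, hl, map_one]
    have h1 := hmap hS.2.1
    have h2 := hmap hZ1
    obtain ⟨r, rfl⟩ : ∃ r : List G, (r : Multiset G) = R := Quot.exists_rep R
    simp only [Multiset.map_cons, Multiset.prod_cons, Multiset.map_add, Multiset.prod_add, h2,
      one_mul, Multiset.map_coe, Multiset.prod_coe, ← map_list_prod] at h1
    have hw1 : x * (y * r.prod) ∈ Subgroup.center G := (hπk _).mp (by simpa using h1)
    have hw2 : y * (x * r.prod) ∈ Subgroup.center G := (hπk _).mp (by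
      rw [map_mul, map_mul, mul_left_comm, h1])
    have hor : x * (y * r.prod) = 1 ∨ y * (x * r.prod) = 1 := by
      by_contra! h
      have hnd : [(1 : Subgroup.center G), ⟨_, hw1⟩, ⟨_, hw2⟩].Nodup := by
        simp only [List.nodup_cons, List.mem_cons, List.not_mem_nil, or_false, not_or,
          not_false_eq_true, List.nodup_nil, and_true]
        refine ⟨⟨fun he => h.1 (congrArg Subtype.val he).symm,
          fun he => h.2 (congrArg Subtype.val he).symm⟩, fun he => hxy ?_⟩
        have := congrArg Subtype.val he
        simpa [← mul_assoc] using this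
      have := Fintype.ofFinite (Subgroup.center G)
      have := hnd.length_le_card
      rw [← Nat.card_eq_fintype_card, hZ2] at this
      simp at this
    refine hS.sub_false (T := x ::ₘ y ::ₘ (r : Multiset G)) ?_ (by simp) hZ0 ?_ hZ1
    · rw [Multiset.cons_add, Multiset.cons_add, add_comm]
    · rcases hor with h | h
      · exact ⟨x :: y :: r, rfl, by simpa using h⟩
      · exact ⟨y :: x :: r, Multiset.coe_eq_coe.mpr (List.Perm.swap ..), by simpa using h⟩

theorem mul_pow_eq_mul_pow_choose_two {G : Type*} [Group G] {y z d : G} (hy : Commute d y)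
    (hz : Commute d z) (h : z * y = y * (z * d)) (k : ℕ) :
    (y * z) ^ k = y ^ k * z ^ k * d ^ k.choose 2 := by
  induction k with
  | zero => simp
  | succ k ih =>
    have h1 : z ^ k * y = y * (z ^ k * d ^ k) := by
      rw [← hz.symm.mul_pow]
      exact (SemiconjBy.pow_right (show SemiconjBy y (z * d) z from h.symm) k).eq.symm
    have h2 : d ^ k.choose 2 * (y * z) = y * z * d ^ k.choose 2 :=
      ((hy.mul_right hz).pow_left _).eq
    have h3 : d ^ k * z = z * d ^ k := (hz.pow_left k).eq
    calc (y * z) ^ (k + 1) = y ^ k * (z ^ k * (d ^ k.choose 2 * (y * z))) := by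
          rw [pow_succ, ih]; group
      _ = y ^ k * ((z ^ k * y) * z * d ^ k.choose 2) := by rw [h2]; simp only [mul_assoc]
      _ = y ^ k * y * z ^ k * (d ^ k * z) * d ^ k.choose 2 := by
          rw [h1]; simp only [mul_assoc]
      _ = y ^ (k + 1) * z ^ (k + 1) * d ^ (k + 1).choose 2 := by
          rw [h3, Nat.choose_succ_succ' k 1, Nat.choose_one_right, pow_succ y, pow_succ z, pow_add]
          simp only [mul_assoc]

theorem ShortAtoms.of_forall_isCyclic {G : Type*} [Group G] {p n : ℕ} [Fact p.Prime]
    (hG : Nat.card G = p ^ n) (hcyc : ¬ IsCyclic G)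
    (hsub : ∀ H : Subgroup G, H ≠ ⊤ → IsCyclic H) : ShortAtoms G := by
  have hp : p.Prime := Fact.out
  have : Finite G := Nat.finite_of_card_ne_zero (by rw [hG]; exact pow_ne_zero _ hp.ne_zero)
  obtain _ | _ | m := n
  · rw [pow_zero, Nat.card_eq_one_iff_unique] at hG
    have := hG.1
    exact absurd (inferInstance : IsCyclic G) hcyc
  · exact absurd (isCyclic_of_prime_card (p := p) (by simpa using hG)) hcyc
  have hexp : ∀ g : G, g ^ p ^ (m + 1) = 1 := fun g => by
    obtain ⟨k, hk, hgk⟩ := (Nat.dvd_prime_pow hp).mp (hG ▸ orderOf_dvd_natCard g)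
    have hne : k ≠ m + 2 := by
      rintro rfl
      exact hcyc (isCyclic_of_orderOf_eq_card g (hgk.trans hG.symm))
    exact orderOf_dvd_iff_pow_eq_one.mp (hgk ▸ pow_dvd_pow p (by omega))
  obtain ⟨M, hM⟩ := Sylow.exists_subgroup_card_pow_prime (G := G) p (n := m + 1)
    (hG ▸ pow_dvd_pow p (by omega))
  have hMi : M.index = p := by
    have := M.card_mul_index
    rw [hM, hG, pow_succ p (m + 1)] at this
    exact Nat.eq_of_mul_eq_mul_left (pow_pos hp.pos _) this
  have hMt : M ≠ ⊤ := fun h => hp.ne_one (hMi.symm.trans (Subgroup.index_eq_one.mpr h))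
  have hMn : M.Normal := Subgroup.normal_of_index_eq_minFac_card (by
    rw [hMi, hG, hp.pow_minFac (by omega)])
  obtain ⟨x, hxM⟩ := (Subgroup.isCyclic_iff_exists_zpowers_eq_top M).mp (hsub M hMt)
  have hxo : orderOf x = p ^ (m + 1) := by rw [← Nat.card_zpowers, hxM, hM]
  have hxmem : x ∈ M := hxM ▸ Subgroup.mem_zpowers x
  have hroot : ∀ g ∈ M, g ^ p ^ m = 1 → ∃ i : ℤ, g = x ^ ((p : ℤ) * i) := fun g hg h => by
    rw [← hxM] at hg
    obtain ⟨k, rfl⟩ := Subgroup.mem_zpowers_iff.mp hg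
    rw [← zpow_natCast, ← zpow_mul, ← orderOf_dvd_iff_zpow_eq_one, hxo, pow_succ'] at h
    push_cast at h
    obtain ⟨i, rfl⟩ := Int.dvd_of_mul_dvd_mul_right
      (pow_ne_zero m (Int.natCast_ne_zero.mpr hp.ne_zero)) h
    exact ⟨i, rfl⟩
  have hfin : ∀ w ∉ M, w ^ p = 1 → Commute (x ^ p ^ m) w → ShortAtoms G := fun w hw hwp hc => by
    refine ShortAtoms.of_commute (p := p) ?_ ?_ hc fun h => hw ?_
    · rw [orderOf_pow_of_dvd (pow_ne_zero _ hp.ne_zero) (hxo ▸ pow_dvd_pow p (by omega)), hxo,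
        pow_succ, Nat.mul_div_cancel_left _ (pow_pos hp.pos _)]
    · exact orderOf_eq_prime hwp fun h => hw (h ▸ M.one_mem)
    · exact (Subgroup.zpowers_le.mpr (M.pow_mem hxmem _)) h
  obtain ⟨y, hy⟩ : ∃ y, y ∉ M := by
    by_contra! h
    exact hMt ((Subgroup.eq_top_iff' M).mpr h)
  obtain _ | m := m
  · refine hfin y hy (by simpa using hexp y) ?_
    exact (IsPGroup.isMulCommutative_of_card_eq_prime_sq hG).is_comm.comm _ _
  obtain ⟨i, hi⟩ : ∃ i : ℤ, y ^ p = x ^ ((p : ℤ) * i) :=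
    hroot _ (hMi ▸ M.pow_index_mem y) (by rw [← pow_mul, ← pow_succ', hexp])
  have hconj : ∀ g, ∃ k : ℤ, x ^ k = g * x * g⁻¹ := fun g =>
    Subgroup.mem_zpowers_iff.mp (hxM ▸ hMn.conj_mem x hxmem g)
  have hNn : (Subgroup.zpowers (x ^ p)).Normal := ⟨fun a ha g => by
    obtain ⟨j, rfl⟩ := Subgroup.mem_zpowers_iff.mp ha
    obtain ⟨k, hk⟩ := hconj g
    refine Subgroup.mem_zpowers_iff.mpr ⟨k * j, ?_⟩
    rw [← conj_zpow, ← conj_pow, ← hk, ← zpow_natCast, ← zpow_natCast, ← zpow_mul, ← zpow_mul,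
      ← zpow_mul]
    congr 1
    ring⟩
  have hyu : Commute (x ^ p) y := by
    set π := QuotientGroup.mk' (Subgroup.zpowers (x ^ p)) with hπ
    have hker : ∀ g, π g = 1 ↔ g ∈ Subgroup.zpowers (x ^ p) := fun g => QuotientGroup.eq_one_iff g
    have hK : (Subgroup.zpowers (π y)).comap π ≠ ⊤ := fun h => by
      have h1 : Subgroup.zpowers (π y) = ⊤ :=
        Subgroup.comap_injective (QuotientGroup.mk'_surjective _) (h.trans (Subgroup.comap_top _).symm)
      have h2 : orderOf (π y) = (Subgroup.zpowers (x ^ p)).index := by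
        rw [← Nat.card_zpowers, h1, Subgroup.card_top, Subgroup.index]
      have h3 : orderOf (π y) ∣ p := orderOf_dvd_of_pow_eq_one (by
        rw [← map_pow, hker, hi, zpow_mul, zpow_natCast]
        exact Subgroup.zpow_mem_zpowers _ _)
      have h4 := (Subgroup.zpowers (x ^ p)).card_mul_index
      rw [← h2, Nat.card_zpowers, orderOf_pow_of_dvd hp.ne_zero (hxo ▸ dvd_pow_self p (by omega)),
        hxo, pow_succ, Nat.mul_div_cancel _ hp.pos, hG, pow_succ p (m + 2), pow_succ p (m + 1),
        mul_assoc] at h4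
      have h5 := Nat.eq_of_mul_eq_mul_left (pow_pos hp.pos _) h4
      have h6 := Nat.le_of_dvd hp.pos h3
      nlinarith [hp.two_le]
    obtain ⟨g, hg⟩ := (Subgroup.isCyclic_iff_exists_zpowers_eq_top _).mp (hsub _ hK)
    obtain ⟨a, ha⟩ : x ^ p ∈ Subgroup.zpowers g := by
      rw [hg, Subgroup.mem_comap, (hker _).mpr (Subgroup.mem_zpowers _)]
      exact Subgroup.one_mem _
    obtain ⟨b, hb⟩ : y ∈ Subgroup.zpowers g := by
      rw [hg, Subgroup.mem_comap]
      exact Subgroup.mem_zpowers _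
    have hab := (Commute.refl g).zpow_zpow a b
    simp only at ha hb
    rwa [ha, hb] at hab
  have hcy : ∀ g ∈ M, g ^ p = 1 → Commute g y ∧ ∃ j : ℤ, g = x ^ ((p : ℤ) * j) := fun g hg h => by
    obtain ⟨j, rfl⟩ := hroot g hg (by rw [pow_succ', pow_mul, h, one_pow])
    refine ⟨?_, j, rfl⟩
    rw [zpow_mul, zpow_natCast]
    exact hyu.zpow_left j
  have hMc : ∀ a ∈ M, ∀ b ∈ M, Commute a b := by
    rw [← hxM]
    rintro _ ⟨a, rfl⟩ _ ⟨b, rfl⟩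
    exact (Commute.refl x).zpow_zpow a b
  set z := x ^ (-i) with hz
  have hzM : z ∈ M := M.zpow_mem hxmem _
  set d := z⁻¹ * (y⁻¹ * z * y) with hd
  have hdM : d ∈ M := M.mul_mem (M.inv_mem hzM) (by simpa using hMn.conj_mem z hzM y⁻¹)
  have hzp : z ^ p = (x ^ p) ^ (-i) := by
    rw [hz, ← zpow_natCast, ← zpow_mul, mul_comm, zpow_mul, zpow_natCast]
  have hdp : d ^ p = 1 := by
    have h1 : (z * d) ^ p = z ^ p := by
      have h2 : z * d = y⁻¹ * z * y⁻¹⁻¹ := by rw [hd]; group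
      have h3 : Commute (z ^ p) y := hzp ▸ hyu.zpow_left _
      rw [h2, conj_pow, inv_inv, mul_assoc, h3.eq, inv_mul_cancel_left]
    rw [(hMc z hzM d hdM).mul_pow] at h1
    exact mul_eq_left.mp h1
  obtain ⟨hdy, j, hj⟩ := hcy d hdM hdp
  have hzy : z * y = y * (z * d) := by rw [hd]; group
  have hpow : (y * z) ^ p = d ^ p.choose 2 := by
    rw [mul_pow_eq_mul_pow_choose_two hdy (hMc d hdM z hzM) hzy, hi, hzp, zpow_mul, zpow_natCast,
      ← zpow_add, add_neg_cancel, zpow_zero, one_mul]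
  have hyz : ∀ v ∈ M, y * z * v ∉ M := fun v hv h =>
    hy ((M.mul_mem_cancel_right (M.mul_mem hzM hv)).mp (by rwa [mul_assoc] at h))
  have hxp : x ^ p ∈ M := M.pow_mem hxmem p
  have huz : Commute (x ^ p) (y * z) := hyu.mul_right (hMc _ hxp z hzM)
  have hfin' : ∀ v ∈ M, (y * z * v) ^ p = 1 → ShortAtoms G := fun v hv h =>
    hfin _ (hyz v hv) h (by
      rw [pow_succ', pow_mul]
      exact (huz.mul_right (hMc _ hxp v hv)).pow_left _)
  obtain rfl | hp2 := eq_or_ne p 2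
  · rw [Nat.choose_self, pow_one] at hpow
    obtain _ | m := m
    · by_cases hd1 : d = 1
      · exact hfin' 1 M.one_mem (by rw [mul_one, hpow, hd1])
      · exact ShortAtoms.of_card_eq_eight (by rw [hG]; norm_num)
          ⟨z, y, fun h => hd1 (by simpa using (hzy.symm.trans h))⟩
    · obtain ⟨r, hr⟩ : ∃ r : ℤ, j = 2 * r := by
        have h1 : x ^ (2 * (2 * j)) = 1 := by
          rw [mul_comm 2 (2 * j), zpow_mul]
          exact_mod_cast hj ▸ hdp
        rw [← orderOf_dvd_iff_zpow_eq_one, hxo] at h1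
        push_cast at h1
        have h2 : (2 : ℤ) ^ (m + 1 + 1 + 1) = 8 * 2 ^ m := by ring
        rw [h2] at h1
        obtain ⟨t, ht⟩ := (Dvd.intro _ rfl).trans h1
        exact ⟨t, by linarith⟩
      refine hfin' ((x ^ 2) ^ (-r)) (M.zpow_mem hxp _) ?_
      have h1 : Commute (y * z) ((x ^ 2) ^ (-r)) := huz.symm.zpow_right _
      rw [h1.mul_pow, hpow, hj, hr, ← zpow_natCast, ← zpow_natCast, ← zpow_mul, ← zpow_mul,
        ← zpow_add, ← zpow_zero x]
      congr 1
      push_cast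
      ring
  · refine hfin' 1 M.one_mem ?_
    obtain ⟨t, ht⟩ := hp.dvd_choose_self two_ne_zero (by have := hp.two_le; omega)
    rw [mul_one, hpow, ht, pow_mul, hdp, one_pow]

theorem IsPGroup.shortAtoms {p : ℕ} [Fact p.Prime] {G : Type*} [Group G] [Finite G]
    (hG : IsPGroup p G) (hcyc : ¬ IsCyclic G) : ShortAtoms G := by
  induction h : Nat.card G using Nat.strong_induction_on generalizing G with
  | _ k ih =>
  subst h
  by_cases hsub : ∀ H : Subgroup G, H ≠ ⊤ → IsCyclic H
  · obtain ⟨n, hn⟩ := IsPGroup.iff_card.mp hG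
    exact ShortAtoms.of_forall_isCyclic hn hcyc hsub
  · push Not at hsub
    obtain ⟨H, hH, hHc⟩ := hsub
    refine ShortAtoms.of_injective H.subtype H.subtype_injective
      (ih _ ?_ (hG.to_subgroup H) hHc rfl)
    exact lt_of_le_of_ne (Subgroup.card_le_card_group H) fun h => hH (Subgroup.eq_top_of_card_eq H h)

theorem stmt19 (G : Type*) [Group G] [Finite G] (hcyc : ¬ IsCyclic G)
    (hdih : ¬ ∃ n : ℕ, Odd n ∧ Nonempty (G ≃* DihedralGroup n)) :
    4 * largeDavenport G ≤ 3 * Nat.card G := by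
  refine ShortAtoms.largeDavenport_le ?_
  by_cases hZ : IsZGroup G
  · exact IsZGroup.shortAtoms hcyc hdih
  · rw [isZGroup_iff] at hZ
    push Not at hZ
    obtain ⟨p, hp, P, hP⟩ := hZ
    have : Fact p.Prime := ⟨hp⟩
    exact ShortAtoms.of_injective (P : Subgroup G).subtype (Subgroup.subtype_injective _)
      (P.isPGroup'.shortAtoms hP)
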